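/- Let (F, φ) be a TC flow on D² admitting a first strong integral f, and let h ∈ E⁺(F). Then there exists a continuous map H : [0,1] × D² → D² such that: H(0,·) = h; H(t,·) ∈ E⁺(F) for every t ∈ [0,1]; H(1,·) ∈ D^∂(F); if h ∈ D⁺(F), then H(t,·) ∈ D⁺(F) for every t ∈ [0,1]; and if h ∈ E^∂(F), then H(t,·) ∈ E^∂(F) for every t ∈ [0,1]. -/

import Mathlib

open Set

noncomputable section

/-- Points of the plane. -/
abbrev Pt : Type := ℝ × ℝ

/-- The closed unit disk `D² = {x² + y² ≤ 1}`. -/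
def diskD : Set Pt := {p | p.1 ^ 2 + p.2 ^ 2 ≤ 1}

/-- The origin `O = (0,0)`. -/
def ptO : Pt := (0, 0)

/-- The boundary circle `∂D² = {x² + y² = 1}`. -/
def bdD : Set Pt := {p | p.1 ^ 2 + p.2 ^ 2 = 1}

/-- A TC ("topological center") flow on the disk `D²`: a `C^∞` vector field `F` on `D²`
together with its flow `φ`, such that `O` is the unique singular point of `F` in `D²`,
the boundary circle is an orbit, and every nonsingular point is periodic. -/
structure TCFlow where
  /-- the vector field -/
  F : Pt → Pt
  /-- the flow of `F` -/
  φ : Pt → ℝ → Pt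
  F_smooth : ContDiffOn ℝ (⊤ : ℕ∞) F diskD
  φ_smooth : ContDiffOn ℝ (⊤ : ℕ∞) (fun p : Pt × ℝ => φ p.1 p.2) (diskD ×ˢ (univ : Set ℝ))
  φ_mapsTo : ∀ z ∈ diskD, ∀ t : ℝ, φ z t ∈ diskD
  φ_zero : ∀ z ∈ diskD, φ z 0 = z
  φ_add : ∀ z ∈ diskD, ∀ s t : ℝ, φ (φ z s) t = φ z (s + t)
  φ_deriv : ∀ z ∈ diskD, ∀ t : ℝ, HasDerivAt (φ z) (F (φ z t)) t
  F_zero_iff : ∀ z ∈ diskD, (F z = 0 ↔ z = ptO)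
  bd_orbit : ∀ z ∈ bdD, {p : Pt | ∃ t : ℝ, φ z t = p} = bdD
  periodic : ∀ z ∈ diskD, z ≠ ptO → ∃ t : ℝ, 0 < t ∧ φ z t = z

/-- The orbit of a point under the flow. -/
def orb (Φ : TCFlow) (z : Pt) : Set Pt := Set.range (Φ.φ z)

/-- `h ∈ E(F)`: a `C^∞` self-map of `D²` preserving each orbit of `F` and restricting to a
`C^∞` diffeomorphism between some open neighbourhoods of `O` in `D²`. -/
def Emem (Φ : TCFlow) (h : Pt → Pt) : Prop :=
  Set.MapsTo h diskD diskD ∧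
  ContDiffOn ℝ (⊤ : ℕ∞) h diskD ∧
  (∀ z ∈ diskD, h '' orb Φ z = orb Φ z) ∧
  (∃ U V : Set Pt, IsOpen U ∧ IsOpen V ∧ ptO ∈ U ∧ ptO ∈ V ∧ U ⊆ diskD ∧ V ⊆ diskD ∧
    Set.BijOn h U V ∧
    ∃ g : Pt → Pt, ContDiffOn ℝ (⊤ : ℕ∞) g V ∧ ∀ z ∈ U, g (h z) = z)

/-- `h ∈ E⁺(F)`: an element of `E(F)` with positive Jacobian determinant at `O`. -/
def EplMem (Φ : TCFlow) (h : Pt → Pt) : Prop :=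
  Emem Φ h ∧ 0 < LinearMap.det ((fderiv ℝ h ptO) : Pt →ₗ[ℝ] Pt)

/-- `h ∈ E^∂(F)`: an element of `E⁺(F)` fixed on the boundary circle. -/
def EbdMem (Φ : TCFlow) (h : Pt → Pt) : Prop :=
  EplMem Φ h ∧ ∀ z ∈ bdD, h z = z

/-- `h ∈ D(F)`: an element of `E(F)` which is a `C^∞` diffeomorphism of `D²` onto itself. -/
def DmemTC (Φ : TCFlow) (h : Pt → Pt) : Prop :=
  Emem Φ h ∧ Set.BijOn h diskD diskD ∧
  ∃ g : Pt → Pt, ContDiffOn ℝ (⊤ : ℕ∞) g diskD ∧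
    (∀ z ∈ diskD, g (h z) = z) ∧ (∀ z ∈ diskD, h (g z) = z)

/-- `h ∈ D⁺(F) = D(F) ∩ E⁺(F)`. -/
def DplMem (Φ : TCFlow) (h : Pt → Pt) : Prop := DmemTC Φ h ∧ EplMem Φ h

/-- `h ∈ D^∂(F) = D(F) ∩ E^∂(F)`. -/
def DbdMem (Φ : TCFlow) (h : Pt → Pt) : Prop := DmemTC Φ h ∧ EbdMem Φ h

/-- `h ∈ Sh(F)`: `h` is the shift along orbits of `F` via some `C^∞` function
`α : D² → ℝ`. -/
def ShMem (Φ : TCFlow) (h : Pt → Pt) : Prop :=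
  ∃ α : Pt → ℝ, ContDiffOn ℝ (⊤ : ℕ∞) α diskD ∧ ∀ z ∈ diskD, h z = Φ.φ z (α z)

/-- A first strong integral for a TC flow: a continuous function `f : D² → [0,1]`, `C^∞`
and without critical points on `D² ∖ {O}`, with `f⁻¹(0) = {O}`, `f⁻¹(1) = ∂D²`, and whose
level sets are exactly the orbits of the flow. -/
def FirstStrongIntegral (Φ : TCFlow) (f : Pt → ℝ) : Prop :=
  ContinuousOn f diskD ∧
  Set.MapsTo f diskD (Icc (0 : ℝ) 1) ∧
  ContDiffOn ℝ (⊤ : ℕ∞) f (diskD \ {ptO}) ∧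
  (∀ z ∈ diskD \ {ptO}, fderivWithin ℝ f (diskD \ {ptO}) z ≠ 0) ∧
  (∀ z ∈ diskD, (f z = 0 ↔ z = ptO)) ∧
  (∀ z ∈ diskD, (f z = 1 ↔ z ∈ bdD)) ∧
  (∀ c ∈ Icc (0 : ℝ) 1, ∃ z ∈ diskD, {w ∈ diskD | f w = c} = orb Φ z)

/-- `θ` is the minimal period function of the TC flow `Φ` on `D² ∖ {O}`. -/
def IsMinPeriod (Φ : TCFlow) (θ : Pt → ℝ) : Prop :=
  ∀ z ∈ diskD \ {ptO},
    0 < θ z ∧ Φ.φ z (θ z) = z ∧ ∀ t : ℝ, 0 < t → t < θ z → Φ.φ z t ≠ z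

section Part1
open Set Filter Topology

lemma exists_equiv_of_inj {F : Type*} [NormedAddCommGroup F] [NormedSpace ℝ F]
    [FiniteDimensional ℝ F] (A : F →L[ℝ] F) (hA : Function.Injective A) :
    ∃ e : F ≃L[ℝ] F, (e : F →L[ℝ] F) = A := by
  refine ⟨(LinearEquiv.ofInjectiveEndo (A : F →ₗ[ℝ] F) hA).toContinuousLinearEquiv, ?_⟩
  ext x
  rfl

/-- Smoothness of a continuous solution of `f (g x) = k x`. -/
lemma contDiffOn_of_comp {E F : Type*} [NormedAddCommGroup E] [NormedSpace ℝ E]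
    [NormedAddCommGroup F] [NormedSpace ℝ F] [FiniteDimensional ℝ F]
    {S : Set E} {T : Set F} (hS : UniqueDiffOn ℝ S) (hT : UniqueDiffOn ℝ T)
    {f : F → F} {g : E → F} {k : E → F}
    (hf : ContDiffOn ℝ (⊤ : ℕ∞) f T) (hk : ContDiffOn ℝ (⊤ : ℕ∞) k S)
    (hg : ContinuousOn g S) (hm : MapsTo g S T) (hfg : ∀ x ∈ S, f (g x) = k x)
    (hinj : ∀ x ∈ S, Function.Injective (fderivWithin ℝ f T (g x))) :
    ContDiffOn ℝ (⊤ : ℕ∞) g S := by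
  have hcomplete : CompleteSpace F := FiniteDimensional.complete ℝ F
  have hf1 : DifferentiableOn ℝ f T := hf.differentiableOn (by simp)
  have hk1 : DifferentiableOn ℝ k S := hk.differentiableOn (by simp)
  have key : ∀ x ∈ S, HasFDerivWithinAt g
      ((ContinuousLinearMap.inverse (fderivWithin ℝ f T (g x))).comp (fderivWithin ℝ k S x)) S x := by
    intro x hx
    obtain ⟨e, he⟩ := exists_equiv_of_inj _ (hinj x hx)
    have h1 := (hf1 _ (hm hx)).hasFDerivWithinAt
    rw [← he] at h1 ⊢
    rw [ContinuousLinearMap.inverse_equiv]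
    refine h1.of_comp_of_leftInverse ?_ (hk1 x hx).hasFDerivWithinAt ?_ (fun v => by simp) hx
    · exact (hg x hx).tendsto_nhdsWithin hm
    · exact eventually_nhdsWithin_of_forall hfg
  have hdiff : DifferentiableOn ℝ g S := fun x hx => (key x hx).differentiableWithinAt
  have hfd : ∀ n : ℕ, ContDiffOn ℝ n (fderivWithin ℝ f T) T := fun n =>
    hf.fderivWithin hT (by exact_mod_cast le_top)
  have hkd : ∀ n : ℕ, ContDiffOn ℝ n (fderivWithin ℝ k S) S := fun n =>
    hk.fderivWithin hS (by exact_mod_cast le_top)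
  have main : ∀ n : ℕ, ContDiffOn ℝ n g S := by
    intro n
    induction n with
    | zero => exact contDiffOn_zero.2 hg
    | succ n ih =>
      push_cast
      refine contDiffOn_succ_of_fderivWithin hdiff (by simp) ?_
      have : ContDiffOn ℝ n (fun x => (ContinuousLinearMap.inverse
          (fderivWithin ℝ f T (g x))).comp (fderivWithin ℝ k S x)) S := by
        refine ContDiffOn.clm_comp ?_ (hkd n)
        intro x hx
        obtain ⟨e, he⟩ := exists_equiv_of_inj _ (hinj x hx)
        have h2 : ContDiffAt ℝ n ContinuousLinearMap.inverse (fderivWithin ℝ f T (g x)) := by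
          rw [← he]; exact contDiffAt_map_inverse e
        exact h2.comp_contDiffWithinAt x (((hfd n).comp ih hm) x hx)
      exact this.congr fun x hx => (key x hx).fderivWithin (hS x hx)
  exact contDiffOn_infty.2 main

/-- scalar implicit version -/
lemma contDiffOn_implicit {E : Type*} [NormedAddCommGroup E] [NormedSpace ℝ E]
    [FiniteDimensional ℝ E] {S : Set E} (hS : UniqueDiffOn ℝ S)
    {Ψ : E × ℝ → ℝ} {k a : E → ℝ} {b : E → ℝ}
    (hΨ : ContDiffOn ℝ (⊤ : ℕ∞) Ψ (S ×ˢ univ)) (hk : ContDiffOn ℝ (⊤ : ℕ∞) k S)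
    (ha : ContinuousOn a S) (h1 : ∀ x ∈ S, Ψ (x, a x) = k x)
    (h2 : ∀ x ∈ S, HasDerivAt (fun s => Ψ (x, s)) (b x) (a x))
    (hb : ∀ x ∈ S, b x ≠ 0) :
    ContDiffOn ℝ (⊤ : ℕ∞) a S := by
  have hT : UniqueDiffOn ℝ (S ×ˢ (univ : Set ℝ)) := hS.prod uniqueDiffOn_univ
  have hG : ContDiffOn ℝ (⊤ : ℕ∞) (fun p : E × ℝ => (p.1, Ψ p)) (S ×ˢ univ) :=
    contDiffOn_fst.prodMk hΨ
  have := contDiffOn_of_comp (f := fun p : E × ℝ => (p.1, Ψ p)) (g := fun x => (x, a x))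
    (k := fun x => (x, k x)) hS hT hG (contDiffOn_id.prodMk hk)
    (continuousOn_id.prodMk ha) (fun x hx => ⟨hx, mem_univ _⟩) (fun x hx => by simp [h1 x hx]) ?_
  · exact contDiff_snd.comp_contDiffOn this
  · intro x hx
    have hmem : (x, a x) ∈ S ×ˢ (univ : Set ℝ) := ⟨hx, mem_univ _⟩
    have hd : HasFDerivWithinAt Ψ (fderivWithin ℝ Ψ (S ×ˢ univ) (x, a x)) (S ×ˢ univ) (x, a x) :=
      ((hΨ.differentiableOn (by simp)) _ hmem).hasFDerivWithinAt
    set L := fderivWithin ℝ Ψ (S ×ˢ univ) (x, a x) with hL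
    have hd2 : HasFDerivWithinAt (fun p : E × ℝ => (p.1, Ψ p))
      ((ContinuousLinearMap.fst ℝ E ℝ).prod L) (S ×ˢ univ) (x, a x) :=
      hasFDerivWithinAt_fst.prodMk hd
    rw [hd2.fderivWithin (hT _ hmem)]
    have hcurve : HasDerivAt (fun s => Ψ (x, s)) (L (0, 1)) (a x) := by
      have hc : HasDerivWithinAt (fun s : ℝ => ((x, s) : E × ℝ)) ((0 : E), (1 : ℝ)) univ (a x) :=
        ((hasDerivAt_const (a x) x).prodMk (hasDerivAt_id (a x))).hasDerivWithinAt
      have := hd.comp_hasDerivWithinAt (a x) hc (fun s _ => ⟨hx, mem_univ _⟩)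
      exact hasDerivWithinAt_univ.1 this
    have hLb : L (0, 1) = b x := hcurve.unique (h2 x hx)
    refine (injective_iff_map_eq_zero _).2 ?_
    rintro ⟨v, s⟩ hvs
    simp only [ContinuousLinearMap.prod_apply, ContinuousLinearMap.coe_fst', Prod.mk_eq_zero] at hvs
    obtain ⟨rfl, h0⟩ := hvs
    have : L (0, s) = s * b x := by
      rw [← hLb, ← smul_eq_mul, ← L.map_smul]; simp
    rw [this] at h0
    have := (mul_eq_zero.1 h0).resolve_right (hb x hx)
    simp [this]

/-! plane linear algebra -/
def crs (v w : Pt) : ℝ := v.1 * w.2 - v.2 * w.1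
def rotJ (v : Pt) : Pt := (-v.2, v.1)
def dot2 (v w : Pt) : ℝ := v.1 * w.1 + v.2 * w.2

lemma dot2_self_pos {v : Pt} (hv : v ≠ 0) : 0 < dot2 v v := by
  unfold dot2
  by_contra hc
  apply hv
  have h1 : v.1 = 0 := by nlinarith [mul_self_nonneg v.1, mul_self_nonneg v.2]
  have h2 : v.2 = 0 := by nlinarith [mul_self_nonneg v.1, mul_self_nonneg v.2]
  exact Prod.ext h1 h2

lemma decomp2 (u v : Pt) : dot2 u u • v = dot2 u v • u + crs u v • rotJ u := by
  unfold dot2 crs rotJ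
  ext <;> simp <;> ring

lemma crs_map (A : Pt →L[ℝ] Pt) (v w : Pt) :
    crs (A v) (A w) = LinearMap.det (A : Pt →ₗ[ℝ] Pt) * crs v w := by
  have hA : ∀ v : Pt, A v = v.1 • A (1, 0) + v.2 • A (0, 1) := by
    intro v
    rw [← A.map_smul, ← A.map_smul, ← A.map_add]; simp
  rw [hA v, hA w, ← LinearMap.det_toMatrix (Module.Basis.finTwoProd ℝ), Matrix.det_fin_two]
  simp [LinearMap.toMatrix_apply, crs]
  ring

/-- functional killing `u`, in terms of the cross product -/
lemma func_eq (L : Pt →L[ℝ] ℝ) (u v : Pt) (h0 : L u = 0) :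
    dot2 u u * L v = crs u v * L (rotJ u) := by
  have := congrArg L (decomp2 u v)
  simpa [h0] using this

lemma func_rot_ne (L : Pt →L[ℝ] ℝ) (u : Pt) (hu : u ≠ 0) (h0 : L u = 0) (hL : L ≠ 0) :
    L (rotJ u) ≠ 0 := by
  intro hc
  apply hL
  refine ContinuousLinearMap.ext fun v => ?_
  have := func_eq L u v h0
  rw [hc, mul_zero] at this
  simpa using (mul_eq_zero.1 this).resolve_left (dot2_self_pos hu).ne'

/-- a vector killed by `L` (nonzero, killing `u`) is a multiple of `u` -/
lemma vec_of_func (L : Pt →L[ℝ] ℝ) (u v : Pt) (hu : u ≠ 0) (h0 : L u = 0) (hL : L ≠ 0)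
    (hv : L v = 0) : ∃ c : ℝ, v = c • u := by
  have h1 := func_eq L u v h0
  rw [hv, mul_zero] at h1
  have h2 := (mul_eq_zero.1 h1.symm).resolve_right (func_rot_ne L u hu h0 hL)
  have h3 := decomp2 u v
  rw [h2, zero_smul, add_zero] at h3
  refine ⟨(dot2 u u)⁻¹ * dot2 u v, ?_⟩
  rw [mul_smul, ← h3, smul_smul, inv_mul_cancel₀ (dot2_self_pos hu).ne', one_smul]

lemma sign_lambda (A : Pt →L[ℝ] Pt) (L L' : Pt →L[ℝ] ℝ) (u u' : Pt) (lam : ℝ)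
    (hu : u ≠ 0) (hu' : u' ≠ 0) (h0' : L' u' = 0)
    (hA : A u = lam • u') (hL : ∀ v, L' (A v) = L v)
    (hs : 0 < L (rotJ u) * L' (rotJ u')) (hdet : 0 < LinearMap.det (A : Pt →ₗ[ℝ] Pt)) :
    0 < lam := by
  have h1 := func_eq L' u' (A (rotJ u)) h0'
  rw [hL] at h1
  have h2 := crs_map A u (rotJ u)
  rw [hA] at h2
  have h3 : crs (lam • u') (A (rotJ u)) = lam * crs u' (A (rotJ u)) := by
    simp [crs]; ring
  have h4 : crs u (rotJ u) = dot2 u u := by simp [crs, rotJ, dot2]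
  rw [h3, h4] at h2
  have hp := dot2_self_pos hu
  have hp' := dot2_self_pos hu'
  set K := L (rotJ u)
  set K' := L' (rotJ u')
  set X := crs u' (A (rotJ u))
  have h5 : lam * (dot2 u' u' * (K * K)) =
      (LinearMap.det (A : Pt →ₗ[ℝ] Pt) * dot2 u u) * (K * K') := by
    rw [← h2]; linear_combination lam * K * h1
  have h6 : 0 < lam * (dot2 u' u' * (K * K)) := by rw [h5]; positivity
  exact (pos_iff_pos_of_mul_pos h6).2 (mul_pos hp' (mul_self_pos.2 (by
    intro hK; rw [hK] at hs; simp at hs)))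

end Part1

section Part2
open Set Filter Topology

/-- punctured disk -/
abbrev Mset : Set Pt := diskD \ {ptO}

lemma convex_disk : Convex ℝ diskD := by
  intro x hx y hy a b ha hb hab
  simp only [diskD, mem_ofPred_eq, Prod.fst_add, Prod.snd_add, Prod.smul_fst, Prod.smul_snd,
    smul_eq_mul] at *
  have hb' : b = 1 - a := by linarith
  subst hb'
  nlinarith [mul_nonneg ha hb, mul_nonneg (mul_nonneg ha hb) (sq_nonneg (x.1 - y.1)),
    mul_nonneg (mul_nonneg ha hb) (sq_nonneg (x.2 - y.2))]

lemma isClosed_disk : IsClosed diskD :=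
  isClosed_le (by fun_prop) (by fun_prop)

lemma isCompact_disk : IsCompact diskD := by
  refine (isCompact_Icc (a := ((-1, -1) : Pt)) (b := (1, 1))).of_isClosed_subset isClosed_disk ?_
  intro p hp
  simp only [diskD, mem_ofPred_eq] at hp
  refine ⟨⟨?_, ?_⟩, ⟨?_, ?_⟩⟩ <;> simp <;> nlinarith [sq_nonneg p.1, sq_nonneg p.2]

lemma openDisk_isOpen : IsOpen {p : Pt | p.1 ^ 2 + p.2 ^ 2 < 1} :=
  isOpen_lt (by fun_prop) (by fun_prop)

lemma ptO_mem : ptO ∈ diskD := by simp [ptO, diskD]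

lemma disk_nhds_O : diskD ∈ 𝓝 ptO :=
  mem_of_superset (openDisk_isOpen.mem_nhds (by simp [ptO])) fun p hp => by
    have h1 : p.1 ^ 2 + p.2 ^ 2 < 1 := hp
    exact h1.le

lemma uniqueDiff_disk : UniqueDiffOn ℝ diskD :=
  uniqueDiffOn_convex convex_disk ⟨ptO, mem_interior_iff_mem_nhds.2 disk_nhds_O⟩

lemma uniqueDiff_M : UniqueDiffOn ℝ Mset := by
  have : Mset = diskD ∩ {ptO}ᶜ := rfl
  rw [this]
  exact uniqueDiff_disk.inter isOpen_compl_singleton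

lemma M_mem_nhdsWithin {z : Pt} (hz : z ∈ Mset) : Mset ∈ 𝓝[diskD] z := by
  have : Mset = diskD ∩ {ptO}ᶜ := rfl
  rw [this]
  exact inter_mem self_mem_nhdsWithin (mem_nhdsWithin_of_mem_nhds (isOpen_compl_singleton.mem_nhds hz.2))

lemma nhdsWithin_M {z : Pt} (hz : z ∈ Mset) : 𝓝[Mset] z = 𝓝[diskD] z :=
  le_antisymm (nhdsWithin_mono _ sdiff_subset) (nhdsWithin_le_of_mem (M_mem_nhdsWithin hz))

lemma bd_subset : bdD ⊆ Mset := by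
  intro p hp
  refine ⟨le_of_eq hp, ?_⟩
  rintro rfl
  simp [bdD, ptO] at hp

lemma sq_pos_of_M {p : Pt} (hp : p ≠ ptO) : 0 < p.1 ^ 2 + p.2 ^ 2 := by
  by_contra hc
  apply hp
  have h1 : p.1 = 0 := by nlinarith [sq_nonneg p.1, sq_nonneg p.2]
  have h2 : p.2 = 0 := by nlinarith [sq_nonneg p.1, sq_nonneg p.2]
  exact Prod.ext h1 h2

lemma preconn_M : IsPreconnected Mset := by
  have : Mset = (fun q : ℝ × ℝ => ((q.1 * Real.cos q.2, q.1 * Real.sin q.2) : Pt)) ''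
      (Ioc (0 : ℝ) 1 ×ˢ (univ : Set ℝ)) := by
    ext p
    constructor
    · rintro ⟨hp, hp0⟩
      have hpos := sq_pos_of_M hp0
      set c : ℂ := ⟨p.1, p.2⟩ with hc
      have hn : ‖c‖ ^ 2 = p.1 ^ 2 + p.2 ^ 2 := by
        rw [← Complex.normSq_eq_norm_sq, Complex.normSq_apply]; simp [hc]; ring
      have hn0 : 0 < ‖c‖ := by
        by_contra h0
        have : ‖c‖ = 0 := le_antisymm (not_lt.1 h0) (norm_nonneg _)
        rw [this] at hn; simp at hn; linarith
      refine ⟨(‖c‖, c.arg), ⟨⟨hn0, ?_⟩, mem_univ _⟩, ?_⟩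
      · have : ‖c‖ ^ 2 ≤ 1 := by rw [hn]; exact hp
        nlinarith
      · have h1 := Complex.norm_mul_cos_arg c
        have h2 := Complex.norm_mul_sin_arg c
        exact Prod.ext h1 h2
    · rintro ⟨⟨r, t⟩, ⟨hr, -⟩, rfl⟩
      have h0 : (r * Real.cos t) ^ 2 + (r * Real.sin t) ^ 2 = r ^ 2 := by
        have := Real.cos_sq_add_sin_sq t
        linear_combination r ^ 2 * this
      refine ⟨?_, ?_⟩
      · simp only [diskD, mem_ofPred_eq]; rw [h0]; nlinarith [hr.1, hr.2]
      · intro h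
        have h' : ((r * Real.cos t, r * Real.sin t) : Pt) = (0, 0) := h
        simp only [Prod.mk.injEq] at h'
        rw [h'.1, h'.2] at h0
        have := hr.1
        simp at h0 this; nlinarith
  rw [this]
  refine (isPreconnected_Ioc.prod isPreconnected_univ).image _ (Continuous.continuousOn (by fun_prop))

namespace TCFlow
variable (Φ : TCFlow)

lemma φ_inv {z : Pt} (hz : z ∈ diskD) (s : ℝ) : Φ.φ (Φ.φ z s) (-s) = z := by
  rw [Φ.φ_add z hz, add_neg_cancel, Φ.φ_zero z hz]

lemma φ_cont : ContinuousOn (fun p : Pt × ℝ => Φ.φ p.1 p.2) (diskD ×ˢ (univ : Set ℝ)) :=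
  Φ.φ_smooth.continuousOn

lemma φ_contT {z : Pt} (hz : z ∈ diskD) : Continuous (Φ.φ z) :=
  continuous_iff_continuousAt.2 fun t => (Φ.φ_deriv z hz t).continuousAt

lemma self_mem_orb {z : Pt} (hz : z ∈ diskD) : z ∈ orb Φ z := ⟨0, Φ.φ_zero z hz⟩

lemma orb_φ {z : Pt} (hz : z ∈ diskD) (s : ℝ) : orb Φ (Φ.φ z s) = orb Φ z := by
  ext w
  constructor
  · rintro ⟨t, rfl⟩
    exact ⟨s + t, (Φ.φ_add z hz s t).symm⟩
  · rintro ⟨t, rfl⟩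
    exact ⟨-s + t, by rw [Φ.φ_add z hz]; congr 1; ring⟩

variable {Φ} {f : Pt → ℝ}

lemma level_eq (hf : FirstStrongIntegral Φ f) {z : Pt} (hz : z ∈ diskD) :
    {w ∈ diskD | f w = f z} = orb Φ z := by
  obtain ⟨-, h2, -, -, -, -, h7⟩ := hf
  obtain ⟨z', hz', he⟩ := h7 (f z) (h2 hz)
  rw [he]
  have : z ∈ orb Φ z' := by rw [← he]; exact ⟨hz, rfl⟩
  obtain ⟨s, rfl⟩ := this
  rw [orb_φ Φ hz']

lemma f_φ (hf : FirstStrongIntegral Φ f) {z : Pt} (hz : z ∈ diskD) (s : ℝ) :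
    f (Φ.φ z s) = f z := by
  have : Φ.φ z s ∈ {w ∈ diskD | f w = f z} := by rw [level_eq hf hz]; exact ⟨s, rfl⟩
  exact this.2

lemma exists_time (hf : FirstStrongIntegral Φ f) {z w : Pt} (hz : z ∈ diskD) (hw : w ∈ diskD)
    (h : f w = f z) : ∃ s, Φ.φ z s = w := by
  have : w ∈ {w ∈ diskD | f w = f z} := ⟨hw, h⟩
  rw [level_eq hf hz] at this
  exact this

lemma f_pos (hf : FirstStrongIntegral Φ f) {z : Pt} (hz : z ∈ Mset) : 0 < f z := by
  have h1 := (hf.2.1 hz.1).1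
  rcases h1.lt_or_eq with h | h
  · exact h
  · exact absurd ((hf.2.2.2.2.1 z hz.1).1 h.symm) hz.2

lemma f_O (hf : FirstStrongIntegral Φ f) : f ptO = 0 := (hf.2.2.2.2.1 _ ptO_mem).2 rfl

lemma M_iff (hf : FirstStrongIntegral Φ f) {z : Pt} (hz : z ∈ diskD) : z ∈ Mset ↔ 0 < f z := by
  refine ⟨f_pos hf, fun h => ⟨hz, ?_⟩⟩
  rintro rfl
  rw [f_O hf] at h; exact lt_irrefl _ h

lemma φ_M (hf : FirstStrongIntegral Φ f) {z : Pt} (hz : z ∈ Mset) (s : ℝ) : Φ.φ z s ∈ Mset :=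
  (M_iff hf (Φ.φ_mapsTo z hz.1 s)).2 (by rw [f_φ hf hz.1]; exact f_pos hf hz)

lemma F_ne {z : Pt} (hz : z ∈ Mset) : Φ.F z ≠ 0 := fun h => hz.2 ((Φ.F_zero_iff z hz.1).1 h)

lemma df_has (hf : FirstStrongIntegral Φ f) {z : Pt} (hz : z ∈ Mset) :
    HasFDerivWithinAt f (fderivWithin ℝ f Mset z) Mset z :=
  ((hf.2.2.1.differentiableOn (by simp)) z hz).hasFDerivWithinAt

lemma df_F (hf : FirstStrongIntegral Φ f) {z : Pt} (hz : z ∈ Mset) :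
    fderivWithin ℝ f Mset z (Φ.F z) = 0 := by
  have h1 : HasDerivWithinAt (Φ.φ z) (Φ.F z) univ 0 := by
    have := (Φ.φ_deriv z hz.1 0).hasDerivWithinAt (s := univ)
    rwa [Φ.φ_zero z hz.1] at this
  have h2 := (df_has hf hz)
  have h3 : Φ.φ z 0 = z := Φ.φ_zero z hz.1
  rw [← h3] at h2
  have h4 := h2.comp_hasDerivWithinAt 0 h1 (fun s _ => φ_M hf hz s)
  rw [h3] at h4
  have h5 : HasDerivAt (f ∘ Φ.φ z) 0 0 := by
    have : f ∘ Φ.φ z = fun _ => f z := funext fun s => f_φ hf hz.1 s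
    rw [this]; exact hasDerivAt_const _ _
  exact (hasDerivWithinAt_univ.1 h4).unique h5

lemma df_rot_ne (hf : FirstStrongIntegral Φ f) {z : Pt} (hz : z ∈ Mset) :
    fderivWithin ℝ f Mset z (rotJ (Φ.F z)) ≠ 0 :=
  func_rot_ne _ _ (F_ne hz) (df_F hf hz) (hf.2.2.2.1 z hz)

lemma df_cont (hf : FirstStrongIntegral Φ f) : ContinuousOn (fderivWithin ℝ f Mset) Mset :=
  hf.2.2.1.continuousOn_fderivWithin uniqueDiff_M (by simp)

lemma F_cont : ContinuousOn Φ.F diskD := Φ.F_smooth.continuousOn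

lemma rotJ_cont : Continuous rotJ := by unfold rotJ; fun_prop

/-- nonvanishing continuous functions on `M` have constant sign -/
lemma sign_const {K : Pt → ℝ} (hK : ContinuousOn K Mset) (h0 : ∀ z ∈ Mset, K z ≠ 0)
    {z w : Pt} (hz : z ∈ Mset) (hw : w ∈ Mset) : 0 < K z * K w := by
  by_contra hc
  have hn : K z * K w < 0 := lt_of_le_of_ne (not_lt.1 hc) (mul_ne_zero (h0 z hz) (h0 w hw))
  have hpc := preconn_M.image K hK
  have hz' : K z ∈ K '' Mset := ⟨z, hz, rfl⟩
  have hw' : K w ∈ K '' Mset := ⟨w, hw, rfl⟩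
  have h00 : (0 : ℝ) ∈ K '' Mset := by
    rcases mul_neg_iff.1 hn with ⟨ha, hb⟩ | ⟨ha, hb⟩
    · exact hpc.Icc_subset hw' hz' ⟨hb.le, ha.le⟩
    · exact hpc.Icc_subset hz' hw' ⟨ha.le, hb.le⟩
  obtain ⟨x, hx, hx0⟩ := h00
  exact h0 x hx hx0

lemma rot_sign (hf : FirstStrongIntegral Φ f) {z w : Pt} (hz : z ∈ Mset) (hw : w ∈ Mset) :
    0 < fderivWithin ℝ f Mset z (rotJ (Φ.F z)) * fderivWithin ℝ f Mset w (rotJ (Φ.F w)) := by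
  refine sign_const (K := fun z => fderivWithin ℝ f Mset z (rotJ (Φ.F z))) ?_
    (fun z hz => df_rot_ne hf hz) hz hw
  exact (df_cont hf).clm_apply (rotJ_cont.comp_continuousOn (F_cont.mono sdiff_subset))

end TCFlow
end Part2

section Part3
open Set Filter Topology

abbrev XM : Type := ↥Mset

structure Ctx where
  Φ : TCFlow
  f : Pt → ℝ
  hf : FirstStrongIntegral Φ f

namespace Ctx
open TCFlow
variable (C : Ctx)

def ψ (z : XM) (s : ℝ) : XM := ⟨C.Φ.φ z s, φ_M C.hf z.2 s⟩

@[simp] lemma ψ_coe (z : XM) (s : ℝ) : (C.ψ z s : Pt) = C.Φ.φ z s := rfl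

lemma ψ_add (z : XM) (s t : ℝ) : C.ψ (C.ψ z s) t = C.ψ z (s + t) :=
  Subtype.ext (C.Φ.φ_add z z.2.1 s t)

lemma ψ_zero (z : XM) : C.ψ z 0 = z := Subtype.ext (C.Φ.φ_zero z z.2.1)

lemma ψ_cont : Continuous (fun p : XM × ℝ => C.ψ p.1 p.2) := by
  refine Continuous.subtype_mk ?_ _
  have : Continuous (fun p : XM × ℝ => ((p.1 : Pt), p.2)) := by fun_prop
  exact C.Φ.φ_cont.comp_continuous this (fun p => ⟨p.1.2.1, mem_univ _⟩)

lemma ψ_cont' {A : Type*} [TopologicalSpace A] {a : A → XM} {b : A → ℝ} (ha : Continuous a)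
    (hb : Continuous b) : Continuous (fun x => C.ψ (a x) (b x)) :=
  C.ψ_cont.comp (ha.prodMk hb)

lemma f_cont : Continuous (fun z : XM => C.f z) :=
  C.hf.1.comp_continuous continuous_subtype_val (fun z => z.2.1)

lemma F_contX : Continuous (fun z : XM => C.Φ.F z) :=
  F_cont.comp_continuous continuous_subtype_val (fun z => z.2.1)

lemma f_ψ (z : XM) (s : ℝ) : C.f (C.ψ z s) = C.f z := f_φ C.hf z.2.1 s

lemma exists_timeX {z w : XM} (h : C.f w = C.f z) : ∃ s, C.ψ z s = w := by
  obtain ⟨s, hs⟩ := exists_time C.hf z.2.1 w.2.1 h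
  exact ⟨s, Subtype.ext hs⟩

lemma dot2_cont : Continuous (fun p : Pt × Pt => dot2 p.1 p.2) := by unfold dot2; fun_prop

lemma dot2_deriv {c : ℝ → Pt} {c' v : Pt} {s : ℝ} (hc : HasDerivAt c c' s) :
    HasDerivAt (fun s => dot2 (c s) v) (dot2 c' v) s := by
  unfold dot2
  have h1 := ((ContinuousLinearMap.fst ℝ ℝ ℝ).hasFDerivAt.comp_hasDerivAt s hc)
  have h2 := ((ContinuousLinearMap.snd ℝ ℝ ℝ).hasFDerivAt.comp_hasDerivAt s hc)
  exact (h1.mul_const v.1).add (h2.mul_const v.2)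

lemma mono_lemma (z0 : XM) : ∃ δ > 0, ∃ N ∈ 𝓝 z0, ∀ z ∈ N,
    StrictMonoOn (fun s => dot2 (C.ψ z s : Pt) (C.Φ.F z0)) (Ioo (-δ) δ) := by
  have hk : Continuous (fun p : XM × ℝ => dot2 (C.Φ.F (C.ψ p.1 p.2)) (C.Φ.F z0)) :=
    dot2_cont.comp ((C.F_contX.comp C.ψ_cont).prodMk continuous_const)
  have h0 : 0 < dot2 (C.Φ.F (C.ψ z0 0)) (C.Φ.F z0) := by
    rw [ψ_zero]; exact dot2_self_pos (F_ne z0.2)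
  have hev : ∀ᶠ p : XM × ℝ in 𝓝 (z0, 0), 0 < dot2 (C.Φ.F (C.ψ p.1 p.2)) (C.Φ.F z0) :=
    (hk.tendsto (z0, 0)).eventually (lt_mem_nhds h0)
  rw [nhds_prod_eq] at hev
  obtain ⟨pa, ha, pb, hb, hab⟩ := eventually_prod_iff.1 hev
  obtain ⟨δ, hδ, hδb⟩ := Metric.eventually_nhds_iff.1 hb
  refine ⟨δ, hδ, _, ha, fun z hz => ?_⟩
  have hd : ∀ s, HasDerivAt (fun s => dot2 (C.ψ z s : Pt) (C.Φ.F z0))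
      (dot2 (C.Φ.F (C.ψ z s)) (C.Φ.F z0)) s := fun s =>
    dot2_deriv (C.Φ.φ_deriv z z.2.1 s)
  refine strictMonoOn_of_deriv_pos (convex_Ioo _ _)
    (fun s _ => (hd s).continuousAt.continuousWithinAt) ?_
  intro s hs
  rw [interior_Ioo] at hs
  rw [(hd s).deriv]
  exact hab hz (hδb (by rw [Real.dist_eq, sub_zero, abs_lt]; exact hs))

lemma no_small (z0 : XM) : ∃ δ > 0, ∃ N ∈ 𝓝 z0, ∀ z ∈ N, ∀ s, |s| < δ → C.ψ z s = z → s = 0 := by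
  obtain ⟨δ, hδ, N, hN, h⟩ := C.mono_lemma z0
  refine ⟨δ, hδ, N, hN, fun z hz s hs hp => ?_⟩
  refine (h z hz).injOn (abs_lt.1 hs) ⟨by linarith, hδ⟩ ?_
  simp only [hp, ψ_zero]

lemma local_inj (z0 : XM) : ∃ r > 0, ∀ w w' : XM, dist (w : Pt) z0 < r → dist (w' : Pt) z0 < r →
    C.f w = C.f w' → dot2 w (C.Φ.F z0) = dot2 w' (C.Φ.F z0) → w = w' := by
  set v := rotJ (C.Φ.F z0)
  have hK : ContinuousOn (fun ξ => fderivWithin ℝ C.f Mset ξ v) Mset :=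
    (df_cont C.hf).clm_apply continuousOn_const
  have hev : ∀ᶠ ξ in 𝓝[Mset] (z0 : Pt), fderivWithin ℝ C.f Mset ξ v ≠ 0 :=
    (hK z0 z0.2).eventually_ne (df_rot_ne C.hf z0.2)
  rw [nhdsWithin_M z0.2] at hev
  have hev2 := hev.and (M_mem_nhdsWithin z0.2)
  obtain ⟨r, hr, hball⟩ := Metric.mem_nhdsWithin_iff.1 hev2
  refine ⟨r, hr, fun w w' hw hw' hff hT => ?_⟩
  have hconv : Convex ℝ (Metric.ball (z0 : Pt) r ∩ diskD) := (convex_ball _ _).inter convex_disk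
  have hsub : Metric.ball (z0 : Pt) r ∩ diskD ⊆ Mset := fun x hx => (hball hx).2
  obtain ⟨ξ, hξ, he⟩ := domain_mvt (f := C.f) (s := Metric.ball (z0 : Pt) r ∩ diskD)
    (f' := fderivWithin ℝ C.f Mset) (fun x hx => (df_has C.hf (hsub hx)).mono hsub) hconv
    (x := w') (y := w) ⟨hw', w'.2.1⟩ ⟨hw, w.2.1⟩
  have hξB := hconv.segment_subset ⟨hw', w'.2.1⟩ ⟨hw, w.2.1⟩ hξ
  have hne := (hball hξB).1
  rw [hff, sub_self] at he
  have hdec := decomp2 (C.Φ.F z0) ((w : Pt) - w')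
  have hd0 : dot2 (C.Φ.F z0) ((w : Pt) - w') = 0 := by
    unfold dot2 at hT ⊢; simp; linarith
  rw [hd0, zero_smul, zero_add] at hdec
  have h1 := congrArg (fderivWithin ℝ C.f Mset ξ) hdec
  rw [map_smul, map_smul, ← he, smul_zero, smul_eq_mul] at h1
  have h2 := (mul_eq_zero.1 h1.symm).resolve_right hne
  rw [h2, zero_smul] at hdec
  have h3 := (smul_eq_zero.1 hdec).resolve_left (dot2_self_pos (F_ne z0.2)).ne'
  exact Subtype.ext (sub_eq_zero.1 h3)

lemma local_time0 (z0 : XM) {δ : ℝ} (hδ : 0 < δ) : ∀ᶠ p : XM × XM in 𝓝 (z0, z0),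
    C.f p.1 = C.f p.2 → ∃ s, |s| < δ ∧ C.ψ p.1 s = p.2 := by
  obtain ⟨δ1, hδ1, N, hN, hmono⟩ := C.mono_lemma z0
  obtain ⟨r, hr, hinj⟩ := C.local_inj z0
  have hev : ∀ᶠ p : XM × ℝ in 𝓝 (z0, 0), dist (C.ψ p.1 p.2 : Pt) z0 < r := by
    have hc : Continuous (fun p : XM × ℝ => dist (C.ψ p.1 p.2 : Pt) z0) :=
      (continuous_subtype_val.comp C.ψ_cont).dist continuous_const
    refine (hc.tendsto (z0, 0)).eventually (gt_mem_nhds ?_)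
    simp only [ψ_zero, dist_self]; exact hr
  rw [nhds_prod_eq] at hev
  obtain ⟨pa, ha, pb, hb, hab⟩ := eventually_prod_iff.1 hev
  obtain ⟨δ2, hδ2, hδb⟩ := Metric.eventually_nhds_iff.1 hb
  obtain ⟨η, hη, hη1, hη2, hη3⟩ : ∃ η : ℝ, 0 < η ∧ η < δ ∧ η < δ1 ∧ η < δ2 := by
    refine ⟨min δ (min δ1 δ2) / 2, by positivity, ?_, ?_, ?_⟩
    · have := min_le_left δ (min δ1 δ2); linarith
    · have := (min_le_right δ (min δ1 δ2)).trans (min_le_left _ _); linarith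
    · have := (min_le_right δ (min δ1 δ2)).trans (min_le_right _ _); linarith
  set T : XM → ℝ := fun z => dot2 (z : Pt) (C.Φ.F z0) with hT
  have hTc : Continuous T := dot2_cont.comp (continuous_subtype_val.prodMk continuous_const)
  have hm0 := hmono z0 (mem_of_mem_nhds hN)
  have e1 : ∀ᶠ p : XM × XM in 𝓝 (z0, z0), T (C.ψ p.1 (-η)) < T p.2 := by
    have c1 : Continuous (fun p : XM × XM => T (C.ψ p.1 (-η))) :=
      hTc.comp (C.ψ_cont' continuous_fst continuous_const)
    have c2 : Continuous (fun p : XM × XM => T p.2) := hTc.comp continuous_snd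
    refine (c1.tendsto _).eventually_lt (c2.tendsto _) ?_
    have := hm0 (a := -η) (b := 0) ⟨by linarith, by linarith⟩ ⟨by linarith, hδ1⟩ (by linarith)
    simpa [ψ_zero, hT, C.Φ.φ_zero _ z0.2.1] using this
  have e2 : ∀ᶠ p : XM × XM in 𝓝 (z0, z0), T p.2 < T (C.ψ p.1 η) := by
    have c1 : Continuous (fun p : XM × XM => T (C.ψ p.1 η)) :=
      hTc.comp (C.ψ_cont' continuous_fst continuous_const)
    have c2 : Continuous (fun p : XM × XM => T p.2) := hTc.comp continuous_snd
    refine (c2.tendsto _).eventually_lt (c1.tendsto _) ?_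
    have := hm0 (a := 0) (b := η) ⟨by linarith, hδ1⟩ ⟨by linarith, by linarith⟩ (by linarith)
    simpa [ψ_zero, hT, C.Φ.φ_zero _ z0.2.1] using this
  have e3 : ∀ᶠ p : XM × XM in 𝓝 (z0, z0), pa p.1 :=
    (continuous_fst.tendsto (z0, z0)).eventually ha
  have e4 : ∀ᶠ p : XM × XM in 𝓝 (z0, z0), dist (p.2 : Pt) z0 < r := by
    have c1 : Continuous (fun p : XM × XM => dist (p.2 : Pt) z0) := by fun_prop
    exact (c1.tendsto _).eventually (gt_mem_nhds (by simpa using hr))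
  filter_upwards [e1, e2, e3, e4] with p h1 h2 h3 h4 hff
  have hTs : ContinuousOn (fun s => T (C.ψ p.1 s)) (Icc (-η) η) :=
    (hTc.comp (C.ψ_cont' continuous_const continuous_id)).continuousOn
  obtain ⟨s, hs, hse⟩ := intermediate_value_Ioo (by linarith) hTs ⟨h1, h2⟩
  refine ⟨s, (abs_lt.2 hs).trans hη1, ?_⟩
  refine hinj _ _ (hab h3 (hδb ?_)) h4 ((C.f_ψ _ _).trans hff) hse
  rw [Real.dist_eq, sub_zero]; exact (abs_lt.2 hs).trans hη3

lemma local_time (z0 : XM) (s0 : ℝ) {δ : ℝ} (hδ : 0 < δ) :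
    ∀ᶠ p : XM × XM in 𝓝 (z0, C.ψ z0 s0),
    C.f p.1 = C.f p.2 → ∃ s, |s - s0| < δ ∧ C.ψ p.1 s = p.2 := by
  have h := C.local_time0 (C.ψ z0 s0) hδ
  have c : Continuous (fun p : XM × XM => (C.ψ p.1 s0, p.2)) :=
    (C.ψ_cont' continuous_fst continuous_const).prodMk continuous_snd
  filter_upwards [(c.tendsto (z0, C.ψ z0 s0)).eventually h] with p hp hff
  obtain ⟨s, hs, he⟩ := hp ((C.f_ψ _ _).trans hff)
  refine ⟨s0 + s, by simpa using hs, ?_⟩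
  rw [← he]; exact (C.ψ_add _ _ _).symm

/-- period subgroup -/
def per (z : XM) : AddSubgroup ℝ where
  carrier := {s | C.ψ z s = z}
  zero_mem' := C.ψ_zero z
  add_mem' := by
    intro a b (ha : C.ψ z a = z) (hb : C.ψ z b = z)
    change C.ψ z (a + b) = z
    rw [← ψ_add, ha, hb]
  neg_mem' := by
    intro a (ha : C.ψ z a = z)
    change C.ψ z (-a) = z
    conv_lhs => rw [← ha]
    rw [ψ_add, add_neg_cancel, ψ_zero]

lemma mem_per {z : XM} {s : ℝ} : s ∈ C.per z ↔ C.ψ z s = z := Iff.rfl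

lemma per_ψ (z : XM) (s : ℝ) : C.per (C.ψ z s) = C.per z := by
  ext t
  rw [mem_per, mem_per, ψ_add]
  constructor
  · intro h
    have := congrArg (fun w => C.ψ w (-s)) h
    simp only [ψ_add] at this
    rw [show s + t + -s = t by ring, show s + -s = 0 by ring, ψ_zero] at this
    exact this
  · intro h
    rw [add_comm, ← ψ_add, h]

lemma ψ_eq_iff {z : XM} {s t : ℝ} : C.ψ z s = C.ψ z t ↔ s - t ∈ C.per z := by
  rw [mem_per]
  constructor
  · intro h
    have := congrArg (fun w => C.ψ w (-t)) h
    simp only [ψ_add] at this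
    rw [show t + -t = 0 by ring, ψ_zero] at this
    exact this
  · intro h
    have := congrArg (fun w => C.ψ w t) h
    simp only [ψ_add] at this
    rwa [sub_add_cancel] at this

lemma exists_least (z : XM) : ∃ a, IsLeast {g : ℝ | g ∈ C.per z ∧ 0 < g} a := by
  obtain ⟨δ, hδ, N, hN, h⟩ := C.no_small z
  have hbot : C.per z ≠ ⊥ := by
    obtain ⟨t, ht, he⟩ := C.Φ.periodic z z.2.1 z.2.2
    intro hb
    have : t ∈ C.per z := Subtype.ext he
    rw [hb] at this
    exact ht.ne' this
  refine AddSubgroup.exists_isLeast_pos hbot hδ ?_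
  rw [Set.disjoint_left]
  intro s hs hs2
  exact hs2.1.ne' (h z (mem_of_mem_nhds hN) s (abs_lt.2 ⟨by linarith [hs2.1], hs2.2⟩) hs)

def θ (z : XM) : ℝ := sInf {g : ℝ | g ∈ C.per z ∧ 0 < g}

lemma θ_least (z : XM) : IsLeast {g : ℝ | g ∈ C.per z ∧ 0 < g} (C.θ z) := by
  obtain ⟨a, ha⟩ := C.exists_least z
  rw [θ, ha.csInf_eq]; exact ha

lemma θ_pos (z : XM) : 0 < C.θ z := (C.θ_least z).1.2
lemma θ_per (z : XM) : C.θ z ∈ C.per z := (C.θ_least z).1.1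
lemma θ_ψ (z : XM) (s : ℝ) : C.θ (C.ψ z s) = C.θ z := by rw [θ, θ, per_ψ]

lemma per_int {z : XM} {s : ℝ} (hs : s ∈ C.per z) : ∃ k : ℤ, s = k * C.θ z := by
  rw [AddSubgroup.cyclic_of_min (C.θ_least z)] at hs
  obtain ⟨k, hk⟩ := AddSubgroup.mem_closure_singleton.1 hs
  exact ⟨k, by rw [← hk]; simp⟩

lemma int_per (z : XM) (k : ℤ) : (k : ℝ) * C.θ z ∈ C.per z := by
  have := (C.per z).zsmul_mem (C.θ_per z) k
  simpa using this

lemma θ_cont : Continuous C.θ := by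
  rw [continuous_iff_continuousAt]
  intro z0
  rw [Metric.continuousAt_iff']
  intro ε hε
  obtain ⟨δ, hδ, N, hN, hns⟩ := C.no_small z0
  set θ0 := C.θ z0 with hθ0
  have hθpos : 0 < θ0 := C.θ_pos z0
  -- upper bound
  have up : ∀ᶠ z in 𝓝 z0, C.θ z < θ0 + ε := by
    have h := C.local_time z0 θ0 (δ := min ε θ0) (lt_min hε hθpos)
    rw [show C.ψ z0 θ0 = z0 from C.θ_per z0] at h
    have c : Continuous (fun z : XM => (z, z)) := by fun_prop
    filter_upwards [(c.tendsto z0).eventually h] with z hz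
    obtain ⟨s, hs, he⟩ := hz rfl
    have h1 := abs_lt.1 (hs.trans_le (min_le_left _ _))
    have h2 := abs_lt.1 (hs.trans_le (min_le_right _ _))
    have : C.θ z ≤ s := (C.θ_least z).2 ⟨he, by linarith [h2.1]⟩
    linarith [h1.2]
  have low : ∀ᶠ z in 𝓝 z0, ∀ s ∈ Icc δ (θ0 - ε), C.ψ z s ≠ z := by
    refine isCompact_Icc.eventually_forall_of_forall_eventually ?_
    intro s hs
    have c1 : Continuous (fun p : XM × ℝ => p.1) := continuous_fst
    have hne : C.ψ z0 s ≠ z0 := by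
      intro h
      have := (C.θ_least z0).2 ⟨h, lt_of_lt_of_le hδ hs.1⟩
      have := hs.2
      linarith
    exact (isOpen_ne_fun C.ψ_cont c1).mem_nhds hne
  filter_upwards [up, low, hN] with z h1 h2 h3
  rw [Real.dist_eq, abs_lt]
  refine ⟨?_, by linarith⟩
  by_contra hc
  rcases lt_or_ge (C.θ z) δ with h | h
  · exact (C.θ_pos z).ne' (hns z h3 _ (by rw [abs_of_pos (C.θ_pos z)]; exact h) (C.θ_per z))
  · exact h2 _ ⟨h, by linarith⟩ (C.θ_per z)

end Ctx
end Part3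

section Part4
open Set Filter Topology

structure HC extends Ctx where
  h : Pt → Pt
  hh : EplMem Φ h

namespace HC
open TCFlow Ctx
variable (C : HC)

lemma h_maps {z : Pt} (hz : z ∈ diskD) : C.h z ∈ diskD := C.hh.1.1 hz
lemma h_smooth : ContDiffOn ℝ (⊤ : ℕ∞) C.h diskD := C.hh.1.2.1

lemma f_h {z : Pt} (hz : z ∈ diskD) : C.f (C.h z) = C.f z := by
  have h1 : C.h z ∈ orb C.Φ z := by
    rw [← C.hh.1.2.2.1 z hz]; exact ⟨z, self_mem_orb C.Φ hz, rfl⟩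
  obtain ⟨s, hs⟩ := h1
  rw [← hs, f_φ C.hf hz]

lemma h_O : C.h ptO = ptO := by
  have h1 := C.f_h ptO_mem
  rw [f_O C.hf] at h1
  exact (C.hf.2.2.2.2.1 _ (C.h_maps ptO_mem)).1 h1

lemma h_M {z : Pt} (hz : z ∈ Mset) : C.h z ∈ Mset :=
  (M_iff C.hf (C.h_maps hz.1)).2 (by rw [C.f_h hz.1]; exact f_pos C.hf hz)

def hX (z : XM) : XM := ⟨C.h z, C.h_M z.2⟩
@[simp] lemma hX_coe (z : XM) : (C.hX z : Pt) = C.h z := rfl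

lemma hX_cont : Continuous C.hX :=
  Continuous.subtype_mk (C.h_smooth.continuousOn.comp_continuous continuous_subtype_val
    (fun z => z.2.1)) _

lemma f_hX (z : XM) : C.f (C.hX z) = C.f z := C.f_h z.2.1

def tm (z : XM) : ℝ := (C.exists_timeX (C.f_hX z)).choose
lemma tm_spec (z : XM) : C.ψ z (C.tm z) = C.hX z := (C.exists_timeX (C.f_hX z)).choose_spec

def u (z : XM) : AddCircle (1 : ℝ) := ((C.tm z / C.θ z : ℝ) : AddCircle (1 : ℝ))

lemma coe_eq_iff {x y : ℝ} : (x : AddCircle (1 : ℝ)) = y ↔ ∃ k : ℤ, x - y = k := by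
  rw [← sub_eq_zero, ← AddCircle.coe_sub, AddCircle.coe_eq_zero_iff]
  constructor
  · rintro ⟨k, hk⟩; exact ⟨k, by rw [← hk]; simp⟩
  · rintro ⟨k, hk⟩; exact ⟨k, by rw [hk]; simp⟩

lemma u_eq {z : XM} {s : ℝ} (hs : C.ψ z s = C.hX z) : C.u z = ((s / C.θ z : ℝ) : AddCircle (1:ℝ)) := by
  rw [u, coe_eq_iff]
  have h1 := C.ψ_eq_iff.1 ((C.tm_spec z).trans hs.symm)
  obtain ⟨k, hk⟩ := C.per_int h1
  refine ⟨k, ?_⟩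
  have := (C.θ_pos z).ne'
  rw [← sub_div, hk]; field_simp

lemma ψ_of_u {z : XM} {x : ℝ} (hx : C.u z = x) : C.ψ z (x * C.θ z) = C.hX z := by
  rw [← C.tm_spec z, C.ψ_eq_iff]
  rw [u, eq_comm, coe_eq_iff] at hx
  obtain ⟨k, hk⟩ := hx
  have : x * C.θ z - C.tm z = k * C.θ z := by
    rw [← hk]
    have := (C.θ_pos z).ne'
    field_simp
  rw [this]; exact C.int_per z k

lemma u_cont : Continuous C.u := by
  rw [continuous_iff_continuousAt]
  intro z0
  intro N hN
  have h1 : ContinuousAt (fun q : ℝ × ℝ => ((q.1 / q.2 : ℝ) : AddCircle (1:ℝ))) (C.tm z0, C.θ z0) := by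
    refine (AddCircle.continuous_mk' (1:ℝ)).continuousAt.comp ?_
    exact continuousAt_fst.div continuousAt_snd (C.θ_pos z0).ne'
  have h2 := h1.eventually (p := fun y => y ∈ N) hN
  rw [nhds_prod_eq] at h2
  obtain ⟨pa, ha, pb, hb, hab⟩ := eventually_prod_iff.1 h2
  obtain ⟨δ, hδ, hδa⟩ := Metric.eventually_nhds_iff.1 ha
  have h3 := C.local_time z0 (C.tm z0) hδ
  rw [C.tm_spec z0] at h3
  have c : Continuous (fun z : XM => (z, C.hX z)) := continuous_id.prodMk C.hX_cont
  have h4 := (c.tendsto z0).eventually h3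
  have h5 := (C.θ_cont.tendsto z0).eventually hb
  change ∀ᶠ z in 𝓝 z0, C.u z ∈ N
  filter_upwards [h4, h5] with z hz1 hz2
  obtain ⟨s, hs, he⟩ := hz1 (C.f_hX z).symm
  rw [C.u_eq he]
  exact hab (hδa (by rwa [Real.dist_eq])) hz2

abbrev cov : IsCoveringMap ((↑) : ℝ → AddCircle (1 : ℝ)) := AddCircle.isCoveringMap_coe 1

def Hm : C(unitInterval × XM, AddCircle (1:ℝ)) where
  toFun p := C.u (C.ψ p.2 (p.1 * C.θ p.2)) - C.u p.2
  continuous_toFun := by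
    refine (C.u_cont.comp (C.ψ_cont' continuous_snd ?_)).sub (C.u_cont.comp continuous_snd)
    exact (continuous_subtype_val.comp continuous_fst).mul (C.θ_cont.comp continuous_snd)

lemma Hm0 (z : XM) : C.Hm (0, z) = (((0 : C(XM, ℝ)) z : ℝ) : AddCircle (1:ℝ)) := by
  simp [Hm, C.ψ_zero]

def X : C(unitInterval × XM, ℝ) := cov.liftHomotopy C.Hm 0 C.Hm0

lemma X_zero (z : XM) : C.X (0, z) = 0 := cov.liftHomotopy_zero C.Hm 0 C.Hm0 z
lemma X_lift (s : unitInterval) (z : XM) :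
    ((C.X (s, z) : ℝ) : AddCircle (1:ℝ)) = C.u (C.ψ z (s * C.θ z)) - C.u z :=
  congrFun (cov.liftHomotopy_lifts C.Hm 0 C.Hm0) (s, z)

instance : PreconnectedSpace XM := Subtype.preconnectedSpace preconn_M

lemma X_one_coe (z : XM) : ((C.X (1, z) : ℝ) : AddCircle (1:ℝ)) = 0 := by
  rw [X_lift]
  simp only [Set.Icc.coe_one, one_mul]
  rw [show C.ψ z (C.θ z) = z from C.θ_per z, sub_self]

lemma X_one_const (z w : XM) : C.X (1, z) = C.X (1, w) := by
  have := cov.eq_of_comp_eq (A := XM) (g₁ := fun z => C.X (1, z)) (g₂ := fun _ => C.X (1, w))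
    (C.X.continuous.comp (by fun_prop)) continuous_const
    (by funext a; simp only [Function.comp]; rw [X_one_coe, X_one_coe]) w rfl
  exact congrFun this z

/-- the basic formula -/
lemma h_ψ (z : XM) {x0 : ℝ} (hx : C.u z = x0) (s : unitInterval) :
    C.hX (C.ψ z (s * C.θ z)) = C.ψ z ((s + x0 + C.X (s, z)) * C.θ z) := by
  have h1 := C.X_lift s z
  rw [hx, eq_sub_iff_add_eq, ← AddCircle.coe_add] at h1
  have h2 := C.ψ_of_u h1.symm
  rw [C.θ_ψ, C.ψ_add] at h2
  rw [← h2]; congr 1; ring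

/-- derivative of `h` -/
def Dh (z : Pt) : Pt →L[ℝ] Pt := fderivWithin ℝ C.h diskD z

lemma Dh_has {z : Pt} (hz : z ∈ diskD) : HasFDerivWithinAt C.h (C.Dh z) diskD z :=
  ((C.h_smooth.differentiableOn (by simp)) z hz).hasFDerivWithinAt

lemma Dh_cont : ContinuousOn C.Dh diskD :=
  C.h_smooth.continuousOn_fderivWithin uniqueDiff_disk (by simp)

lemma Dh_O : C.Dh ptO = fderiv ℝ C.h ptO := fderivWithin_of_mem_nhds disk_nhds_O

lemma det_cont : ContinuousOn (fun z => (C.Dh z).det) diskD :=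
  ContinuousLinearMap.continuous_det.comp_continuousOn C.Dh_cont

end HC

open TCFlow in
/-- orbit-preserving maps preserve `df` -/
lemma df_comp {Φ : TCFlow} {f : Pt → ℝ} (hf : FirstStrongIntegral Φ f) {k : Pt → Pt} {z : Pt}
    (hz : z ∈ Mset) (hk : MapsTo k Mset Mset) (hfk : ∀ w ∈ Mset, f (k w) = f w) {A : Pt →L[ℝ] Pt}
    (hA : HasFDerivWithinAt k A Mset z) (v : Pt) :
    fderivWithin ℝ f Mset (k z) (A v) = fderivWithin ℝ f Mset z v := by
  have h1 := (df_has hf (hk hz)).comp z hA hk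
  have h2 : HasFDerivWithinAt (f ∘ k) (fderivWithin ℝ f Mset z) Mset z :=
    (df_has hf hz).congr (fun w hw => hfk w hw) (hfk z hz)
  have := (uniqueDiff_M z hz).eq h1 h2
  rw [← this]; rfl

namespace HC
open TCFlow Ctx
variable (C : HC)

lemma lam_pos {z : Pt} (hz : z ∈ Mset) {lam : ℝ} (hl : C.Dh z (C.Φ.F z) = lam • C.Φ.F (C.h z))
    (hd : 0 < (C.Dh z).det) : 0 < lam := by
  refine sign_lambda (C.Dh z) (fderivWithin ℝ C.f Mset z) (fderivWithin ℝ C.f Mset (C.h z))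
    (C.Φ.F z) (C.Φ.F (C.h z)) lam (F_ne hz) (F_ne (C.h_M hz)) ?_ hl ?_ ?_ hd
  · exact df_F C.hf (C.h_M hz)
  · intro v
    exact df_comp C.hf hz (fun w hw => C.h_M hw) (fun w hw => C.f_h hw.1)
      ((C.Dh_has hz.1).mono sdiff_subset) v
  · exact rot_sign C.hf hz (C.h_M hz)

end HC
end Part4

section Part5
open Set Filter Topology

lemma dot2_smooth {E : Type*} [NormedAddCommGroup E] [NormedSpace ℝ E] {S : Set E} {p q : E → Pt}
    (hp : ContDiffOn ℝ (⊤ : ℕ∞) p S) (hq : ContDiffOn ℝ (⊤ : ℕ∞) q S) :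
    ContDiffOn ℝ (⊤ : ℕ∞) (fun x => dot2 (p x) (q x)) S := by
  unfold dot2
  exact (hp.fst.mul hq.fst).add (hp.snd.mul hq.snd)

namespace HC
open TCFlow Ctx
variable (C : HC)

lemma exists_c2 {U : Set Pt} (hU : IsOpen U) (hO : ptO ∈ U) : ∃ c2, 0 < c2 ∧ c2 ≤ 1 ∧
    ∀ z ∈ diskD, C.f z < c2 → z ∈ U ∧ 0 < (C.Dh z).det := by
  have h1 : ∀ᶠ z in 𝓝[diskD] ptO, 0 < (C.Dh z).det := by
    refine (C.det_cont ptO ptO_mem).eventually (lt_mem_nhds ?_)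
    change 0 < (C.Dh ptO).det
    rw [Dh_O]; exact C.hh.2
  obtain ⟨W, hWo, hWO, hW⟩ := mem_nhdsWithin.1 h1
  have hK : IsCompact (diskD \ (U ∩ W)) := isCompact_disk.diff (hU.inter hWo)
  rcases (diskD \ (U ∩ W)).eq_empty_or_nonempty with he | hne
  · refine ⟨1, one_pos, le_rfl, fun z hz _ => ?_⟩
    have : z ∈ U ∩ W := by
      by_contra hc
      have : z ∈ diskD \ (U ∩ W) := ⟨hz, hc⟩
      rw [he] at this; exact this
    exact ⟨this.1, hW ⟨this.2, hz⟩⟩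
  · obtain ⟨m, hm, hmin⟩ := hK.exists_isMinOn hne (C.hf.1.mono sdiff_subset)
    have hmM : m ∈ Mset := ⟨hm.1, by rintro rfl; exact hm.2 ⟨hO, hWO⟩⟩
    refine ⟨C.f m, f_pos C.hf hmM, (C.hf.2.1 hm.1).2, fun z hz hlt => ?_⟩
    have : z ∈ U ∩ W := by
      by_contra hc
      have h2 := hmin (show z ∈ diskD \ (U ∩ W) from ⟨hz, hc⟩)
      exact absurd hlt (not_lt.2 h2)
    exact ⟨this.1, hW ⟨this.2, hz⟩⟩

lemma exists_level {c : ℝ} (hc : c ∈ Icc (0:ℝ) 1) : ∃ z ∈ diskD, C.f z = c := by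
  obtain ⟨z, hz, he⟩ := C.hf.2.2.2.2.2.2 c hc
  have : z ∈ {w ∈ diskD | C.f w = c} := by rw [he]; exact self_mem_orb C.Φ hz
  exact ⟨z, hz, this.2⟩

lemma X_one_zero : ∀ z, C.X (1, z) = 0 := by
  obtain ⟨U, V, hUo, -, hOU, -, hUD, -, hbij, -⟩ := C.hh.1.2.2.2
  obtain ⟨c2, hc0, hc1, hc2⟩ := C.exists_c2 hUo hOU
  obtain ⟨z', hz', hfz'⟩ := C.exists_level (c := c2 / 2) ⟨by linarith, by linarith⟩
  have hzM : z' ∈ Mset := (M_iff C.hf hz').2 (by linarith)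
  set z : XM := ⟨z', hzM⟩ with hz
  have hfz : ∀ s, C.f (C.ψ z s) < c2 := fun s => by
    rw [C.f_ψ]; change C.f z' < c2; linarith
  have hU0 : ∀ s, (C.ψ z s : Pt) ∈ U := fun s => (hc2 _ (C.ψ z s).2.1 (hfz s)).1
  have hd0 : ∀ s, 0 < (C.Dh (C.ψ z s)).det := fun s => (hc2 _ (C.ψ z s).2.1 (hfz s)).2
  intro w
  rw [C.X_one_const w z]
  obtain ⟨x0, hx0⟩ : ∃ x0 : ℝ, C.u z = x0 := ⟨_, rfl⟩
  set T := C.θ z with hT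
  have hTp : 0 < T := C.θ_pos z
  -- the lifted map
  set σ : ℝ → ℝ := fun s => s + x0 + C.X (projIcc 0 1 zero_le_one s, z) with hσ
  have hσc : Continuous σ := by
    have : Continuous (fun s : ℝ => C.X (projIcc 0 1 zero_le_one s, z)) :=
      C.X.continuous.comp (by fun_prop)
    fun_prop
  have hform : ∀ s ∈ Icc (0:ℝ) 1, C.h (C.Φ.φ z (s * T)) = C.Φ.φ z (σ s * T) := by
    intro s hs
    have := C.h_ψ z hx0 ⟨s, hs⟩
    have h2 := congrArg Subtype.val this
    simp only [hX_coe, ψ_coe] at h2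
    rw [hσ]; dsimp only; rw [projIcc_of_mem _ hs]; exact h2
  have hp : ContDiffOn ℝ (⊤ : ℕ∞) (fun s : ℝ => C.Φ.φ z (s * T)) univ := by
    refine C.Φ.φ_smooth.comp (g := fun p : Pt × ℝ => C.Φ.φ p.1 p.2)
      (f := fun s : ℝ => ((z : Pt), s * T)) ?_ (fun s _ => ⟨z.2.1, mem_univ _⟩)
    fun_prop
  have hq : ContDiffOn ℝ (⊤ : ℕ∞) (fun s : ℝ => C.h (C.Φ.φ z (s * T))) univ :=
    C.h_smooth.comp hp (fun s _ => (C.ψ z (s * T)).2.1)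
  have hFq : ContDiffOn ℝ (⊤ : ℕ∞) (fun s : ℝ => C.Φ.F (C.h (C.Φ.φ z (s * T)))) univ :=
    C.Φ.F_smooth.comp hq (fun s _ => (C.hX (C.ψ z (s * T))).2.1)
  have hsm : ContDiffOn ℝ (⊤ : ℕ∞) (fun s => σ s * T) (Icc (0:ℝ) 1) := by
    refine contDiffOn_implicit (uniqueDiffOn_Icc one_pos)
      (Ψ := fun p : ℝ × ℝ => dot2 (C.Φ.φ z p.2) (C.Φ.F (C.h (C.Φ.φ z (p.1 * T)))))
      (k := fun s => dot2 (C.h (C.Φ.φ z (s * T))) (C.Φ.F (C.h (C.Φ.φ z (s * T)))))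
      (b := fun s => dot2 (C.Φ.F (C.h (C.Φ.φ z (s * T)))) (C.Φ.F (C.h (C.Φ.φ z (s * T)))))
      ?_ ?_ ?_ ?_ ?_ ?_
    · refine dot2_smooth ?_ ?_
      · refine C.Φ.φ_smooth.comp (g := fun p : Pt × ℝ => C.Φ.φ p.1 p.2)
          (f := fun p : ℝ × ℝ => ((z : Pt), p.2)) ?_ (fun s _ => ⟨z.2.1, mem_univ _⟩)
        fun_prop
      · exact hFq.comp (f := fun p : ℝ × ℝ => p.1) (by fun_prop) (fun _ _ => mem_univ _)
    · exact (dot2_smooth hq hFq).mono (subset_univ _)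
    · exact (hσc.mul continuous_const).continuousOn
    · intro s hs; simp only; rw [hform s hs]
    · intro s hs
      simp only
      have h1 := C.Φ.φ_deriv z z.2.1 (σ s * T)
      rw [← hform s hs] at h1
      exact dot2_deriv h1
    · intro s hs
      exact (dot2_self_pos (F_ne (C.hX (C.ψ z (s * T))).2)).ne'
  have hder : ∀ s ∈ Ioo (0:ℝ) 1, 0 < deriv (fun s => σ s * T) s := by
    intro s hs
    have hsn : Icc (0:ℝ) 1 ∈ 𝓝 s := Icc_mem_nhds hs.1 hs.2
    have ha : HasDerivAt (fun s => σ s * T) (deriv (fun s => σ s * T) s) s :=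
      (((hsm.differentiableOn (by simp)) s (Ioo_subset_Icc_self hs)).differentiableAt hsn).hasDerivAt
    set a' := deriv (fun s => σ s * T) s
    have h1 : HasDerivAt (fun s => C.Φ.φ z (σ s * T)) (a' • C.Φ.F (C.Φ.φ z (σ s * T))) s :=
      (C.Φ.φ_deriv z z.2.1 (σ s * T)).scomp s ha
    have h2 : HasDerivAt (fun s => C.Φ.φ z (s * T)) (T • C.Φ.F (C.Φ.φ z (s * T))) s := by
      have h0 : HasDerivAt (fun s : ℝ => s * T) T s := by simpa using (hasDerivAt_id s).mul_const T
      exact (C.Φ.φ_deriv z z.2.1 (s * T)).scomp s h0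
    have h3 : HasDerivAt (fun s => C.h (C.Φ.φ z (s * T)))
        (C.Dh (C.Φ.φ z (s * T)) (T • C.Φ.F (C.Φ.φ z (s * T)))) s := by
      have := (C.Dh_has (C.ψ z (s * T)).2.1).comp_hasDerivWithinAt s
        (h2.hasDerivWithinAt (s := univ)) (fun s _ => (C.ψ z (s * T)).2.1)
      exact hasDerivWithinAt_univ.1 this
    have h4 : HasDerivAt (fun s => C.h (C.Φ.φ z (s * T))) (a' • C.Φ.F (C.Φ.φ z (σ s * T))) s := by
      refine h1.congr_of_eventuallyEq ?_
      filter_upwards [hsn] with r hr using hform r hr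
    have h5 := h3.unique h4
    rw [← hform s (Ioo_subset_Icc_self hs), map_smul] at h5
    have h6 : C.Dh (C.ψ z (s * T)) (C.Φ.F (C.ψ z (s * T))) = (T⁻¹ * a') • C.Φ.F (C.h (C.ψ z (s * T))) := by
      rw [mul_smul]
      simp only [ψ_coe]
      rw [← h5, smul_smul, inv_mul_cancel₀ hTp.ne', one_smul]
    have h7 := C.lam_pos (C.ψ z (s * T)).2 h6 (hd0 _)
    exact (pos_iff_pos_of_mul_pos h7).1 (inv_pos.2 hTp)
  have hmono : StrictMonoOn (fun s => σ s * T) (Icc (0:ℝ) 1) := by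
    refine strictMonoOn_of_deriv_pos (convex_Icc _ _) (hσc.mul continuous_const).continuousOn ?_
    rw [interior_Icc]; exact hder
  have hs0 : σ 0 = x0 := by
    simp only [hσ]; rw [projIcc_left, show (⟨0, _⟩ : Icc (0:ℝ) 1) = (0 : unitInterval) from rfl,
      C.X_zero]; ring
  have hs1 : σ 1 = 1 + x0 + C.X (1, z) := by
    simp only [hσ]; rw [projIcc_right]; rfl
  obtain ⟨n, hn⟩ : ∃ n : ℤ, C.X (1, z) = n := by
    have := C.X_one_coe z
    rw [← AddCircle.coe_zero, coe_eq_iff] at this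
    simpa using this
  have h01 : σ 0 < σ 1 := by
    have := hmono (left_mem_Icc.2 zero_le_one) (right_mem_Icc.2 zero_le_one) one_pos
    exact lt_of_mul_lt_mul_right this hTp.le
  have hn0 : 0 ≤ n := by
    rw [hs0, hs1, hn] at h01
    have : (-1:ℝ) < n := by linarith
    have : (-1 : ℤ) < n := by exact_mod_cast this
    omega
  rcases hn0.eq_or_lt with h | h
  · rw [hn, ← h]; simp
  exfalso
  have hn1 : (1:ℝ) ≤ n := by exact_mod_cast h
  obtain ⟨s, hs, hse⟩ : σ 0 + 1 ∈ σ '' Icc 0 1 := by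
    refine intermediate_value_Icc zero_le_one hσc.continuousOn ⟨by linarith, ?_⟩
    rw [hs0, hs1, hn]; linarith
  have e1 : C.h (C.Φ.φ z (s * T)) = C.h (C.Φ.φ z (0 * T)) := by
    rw [hform s hs, hform 0 (left_mem_Icc.2 zero_le_one), hse]
    have : C.ψ z ((σ 0 + 1) * T) = C.ψ z (σ 0 * T) := by
      rw [C.ψ_eq_iff, show (σ 0 + 1) * T - σ 0 * T = T by ring]; exact C.θ_per z
    exact congrArg Subtype.val this
  have e2 : C.ψ z (s * T) = C.ψ z (0 * T) := Subtype.ext (hbij.injOn (hU0 _) (hU0 _) e1)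
  rw [C.ψ_eq_iff, zero_mul, sub_zero] at e2
  have hspos : 0 < s := by
    rcases hs.1.eq_or_lt with h | h
    · rw [← h] at hse; linarith
    · exact h
  have hle : T ≤ s * T := (C.θ_least z).2 ⟨e2, by positivity⟩
  have hs1' : s = 1 := le_antisymm hs.2 (by nlinarith)
  rw [hs1', hs0, hs1, hn] at hse
  linarith

end HC
end Part5

section Part6
open Set Filter Topology

namespace HC
open TCFlow Ctx
variable (C : HC)

abbrev BX : Type := {z : XM // (z : Pt) ∈ bdD}

lemma isCompact_bd : IsCompact bdD :=
  isCompact_disk.of_isClosed_subset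
    (isClosed_eq (by fun_prop) (by fun_prop)) (fun p hp => le_of_eq hp)

lemma exists_bdlift : ∃ y : C(BX, ℝ), (∀ b : BX, ((y b : ℝ) : AddCircle (1:ℝ)) = C.u b.1) ∧
    ((∀ z ∈ bdD, C.h z = z) → y = 0) := by
  by_cases hfix : ∀ z ∈ bdD, C.h z = z
  · refine ⟨0, fun b => ?_, fun _ => rfl⟩
    have : C.ψ b.1 0 = C.hX b.1 := by
      rw [C.ψ_zero]; exact Subtype.ext (hfix _ b.2).symm
    rw [C.u_eq this]; simp
  suffices h : ∃ y : C(BX, ℝ), (∀ b : BX, ((y b : ℝ) : AddCircle (1:ℝ)) = C.u b.1) by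
    obtain ⟨y, hy⟩ := h
    exact ⟨y, hy, fun h => absurd h hfix⟩
  have hb0 : ((1, 0) : Pt) ∈ bdD := by simp [bdD]
  set z0 : XM := ⟨(1, 0), bd_subset hb0⟩ with hz0
  have hbd : ∀ s, (C.ψ z0 s : Pt) ∈ bdD := fun s => by
    rw [← C.Φ.bd_orbit _ hb0]; exact ⟨s, rfl⟩
  let q : unitInterval → BX := fun s => ⟨C.ψ z0 (s * C.θ z0), hbd _⟩
  have hq : Continuous q := Continuous.subtype_mk (C.ψ_cont' continuous_const
    (continuous_subtype_val.mul continuous_const)) _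
  have hsurj : Function.Surjective q := by
    rintro ⟨z, hz⟩
    obtain ⟨t, ht⟩ : ∃ t, C.ψ z0 t = z := by
      rw [← C.Φ.bd_orbit _ hb0] at hz
      obtain ⟨t, ht⟩ := hz
      exact ⟨t, Subtype.ext ht⟩
    have hT := C.θ_pos z0
    refine ⟨⟨Int.fract (t / C.θ z0), Int.fract_nonneg _, (Int.fract_lt_one _).le⟩, ?_⟩
    apply Subtype.ext
    change C.ψ z0 (Int.fract (t / C.θ z0) * C.θ z0) = z
    rw [← ht, C.ψ_eq_iff]
    have : Int.fract (t / C.θ z0) * C.θ z0 - t = ((-⌊t / C.θ z0⌋ : ℤ) : ℝ) * C.θ z0 := by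
      rw [Int.fract]; push_cast; field_simp; ring
    rw [this]; exact C.int_per z0 _
  have hquot : IsQuotientMap q := (hq.isClosedMap).isQuotientMap hq hsurj
  obtain ⟨x0, hx0⟩ : ∃ x0 : ℝ, C.u z0 = x0 := ⟨_, rfl⟩
  let g : C(unitInterval, ℝ) := ⟨fun s => x0 + C.X (s, z0), continuous_const.add
    (C.X.continuous.comp (by fun_prop))⟩
  have hg : Function.FactorsThrough g q := by
    intro s t hst
    have h1 : C.ψ z0 (s * C.θ z0) = C.ψ z0 (t * C.θ z0) := congrArg Subtype.val hst
    rw [C.ψ_eq_iff] at h1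
    obtain ⟨k, hk⟩ := C.per_int h1
    have hT := C.θ_pos z0
    have hk2 : (s : ℝ) - t = k := by
      have : ((s : ℝ) - t - k) * C.θ z0 = 0 := by linarith
      rcases mul_eq_zero.1 this with h | h
      · linarith
      · exact absurd h hT.ne'
    have a1 := s.2.1
    have a2 := s.2.2
    have b1 := t.2.1
    have b2 := t.2.2
    have k1 : -1 ≤ k := by have : (-1:ℝ) ≤ k := by linarith
                           exact_mod_cast this
    have k2 : k ≤ 1 := by have : (k:ℝ) ≤ 1 := by linarith
                          exact_mod_cast this
    change x0 + C.X (s, z0) = x0 + C.X (t, z0)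
    obtain rfl | rfl | rfl : k = -1 ∨ k = 0 ∨ k = 1 := by omega
    · have e1 : s = 0 := Subtype.ext (by push_cast at hk2; change (s:ℝ) = 0; linarith)
      have e2 : t = 1 := Subtype.ext (by push_cast at hk2; change (t:ℝ) = 1; linarith)
      rw [e1, e2, C.X_zero, C.X_one_zero]
    · have e1 : s = t := Subtype.ext (by push_cast at hk2; linarith)
      rw [e1]
    · have e1 : s = 1 := Subtype.ext (by push_cast at hk2; change (s:ℝ) = 1; linarith)
      have e2 : t = 0 := Subtype.ext (by push_cast at hk2; change (t:ℝ) = 0; linarith)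
      rw [e1, e2, C.X_zero, C.X_one_zero]
  let q' : C(unitInterval, BX) := ⟨q, hq⟩
  have hquot' : IsQuotientMap q' := hquot
  have hg' : Function.FactorsThrough g q' := hg
  let y : C(BX, ℝ) := hquot'.lift g hg'
  refine ⟨y, fun b => ?_⟩
  obtain ⟨s, rfl⟩ := hsurj b
  have : y (q s) = g s := congrArg (fun k : C(unitInterval, ℝ) => k s) (hquot'.lift_comp g hg')
  rw [this]
  change ((x0 + C.X (s, z0) : ℝ) : AddCircle (1:ℝ)) = C.u (C.ψ z0 (s * C.θ z0))
  rw [AddCircle.coe_add, C.X_lift, hx0]; abel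

def nrm (p : Pt) : ℝ := Real.sqrt (p.1 ^ 2 + p.2 ^ 2)
lemma nrm_pos (z : XM) : 0 < nrm z := Real.sqrt_pos.2 (sq_pos_of_M z.2.2)
lemma nrm_sq (z : XM) : nrm z ^ 2 = (z : Pt).1 ^ 2 + (z : Pt).2 ^ 2 :=
  Real.sq_sqrt (sq_pos_of_M z.2.2).le
lemma nrm_le (z : XM) : nrm z ≤ 1 := by
  have h : (z : Pt).1 ^ 2 + (z : Pt).2 ^ 2 ≤ 1 := z.2.1
  rw [← nrm_sq] at h
  have := nrm_pos z
  nlinarith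
lemma nrm_cont : Continuous (fun z : XM => nrm z) := by unfold nrm; fun_prop

def sc (t : unitInterval) (z : XM) : ℝ := (1 - t) * (nrm z)⁻¹ + t

lemma sc_mem (t : unitInterval) (z : XM) : sc t z • (z : Pt) ∈ Mset := by
  have h1 := nrm_pos z
  have h2 := nrm_le z
  have h3 : 1 ≤ (nrm z)⁻¹ := (one_le_inv₀ h1).2 h2
  have t0 := t.2.1
  have t1 := t.2.2
  have hpos : 0 < sc t z := by
    unfold sc
    nlinarith
  refine ⟨?_, ?_⟩
  · have hle : sc t z * nrm z ≤ 1 := by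
      unfold sc
      have : ((1 - (t:ℝ)) * (nrm z)⁻¹ + t) * nrm z = (1 - t) + t * nrm z := by
        field_simp
      rw [this]; nlinarith
    change (sc t z * (z : Pt).1) ^ 2 + (sc t z * (z : Pt).2) ^ 2 ≤ 1
    have : (sc t z * (z : Pt).1) ^ 2 + (sc t z * (z : Pt).2) ^ 2 = (sc t z * nrm z) ^ 2 := by
      rw [mul_pow _ (nrm z), nrm_sq]; ring
    rw [this]
    exact pow_le_one₀ (by positivity) hle
  · intro h
    have h0 : sc t z • (z : Pt) = 0 := h
    rcases smul_eq_zero.1 h0 with h | h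
    · exact hpos.ne' h
    · exact z.2.2 h

def rad (p : unitInterval × XM) : XM := ⟨sc p.1 p.2 • (p.2 : Pt), sc_mem p.1 p.2⟩

lemma rad_cont : Continuous rad := by
  refine Continuous.subtype_mk ?_ _
  have h1 : Continuous (fun p : unitInterval × XM => (nrm p.2)⁻¹) :=
    (nrm_cont.comp continuous_snd).inv₀ (fun p => (nrm_pos p.2).ne')
  unfold sc
  fun_prop

lemma rad_one (z : XM) : rad (1, z) = z := by
  apply Subtype.ext; simp [rad, sc]

lemma rad_zero (z : XM) : (rad (0, z) : Pt) ∈ bdD := by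
  have h1 := nrm_pos z
  have : ((nrm z)⁻¹ * (z : Pt).1) ^ 2 + ((nrm z)⁻¹ * (z : Pt).2) ^ 2 = 1 := by
    have := nrm_sq z
    field_simp; linarith
  simpa [rad, sc, bdD] using this

lemma rad_bd (t : unitInterval) (z : XM) (hz : (z : Pt) ∈ bdD) : rad (t, z) = z := by
  have : nrm z = 1 := by
    unfold nrm; rw [show (z : Pt).1 ^ 2 + (z : Pt).2 ^ 2 = 1 from hz, Real.sqrt_one]
  apply Subtype.ext; simp [rad, sc, this]

lemma exists_x : ∃ x : XM → ℝ, Continuous x ∧ (∀ z, ((x z : ℝ) : AddCircle (1:ℝ)) = C.u z) ∧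
    ((∀ z ∈ bdD, C.h z = z) → ∀ z : XM, (z : Pt) ∈ bdD → x z = 0) := by
  obtain ⟨y, hy, hyfix⟩ := C.exists_bdlift
  let R : C(unitInterval × XM, AddCircle (1:ℝ)) := ⟨fun p => C.u (rad p), C.u_cont.comp rad_cont⟩
  let y0 : C(XM, ℝ) := ⟨fun z => y ⟨rad (0, z), rad_zero z⟩, y.continuous.comp
    (Continuous.subtype_mk (rad_cont.comp (by fun_prop)) _)⟩
  have hR0 : ∀ z, R (0, z) = ((y0 z : ℝ) : AddCircle (1:ℝ)) := fun z => (hy ⟨rad (0, z), rad_zero z⟩).symm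
  have hl := cov.liftHomotopy_lifts R y0 hR0
  set L := cov.liftHomotopy R y0 hR0 with hL
  refine ⟨fun z => L (1, z), L.continuous.comp (by fun_prop), fun z => ?_, fun hfix z hz => ?_⟩
  · have := congrFun hl (1, z)
    change ((L (1, z) : ℝ) : AddCircle (1:ℝ)) = C.u (rad (1, z)) at this
    rw [rad_one] at this; exact this
  · have h0 : L (0, z) = 0 := by
      rw [hL, cov.liftHomotopy_zero]
      change y _ = 0
      rw [hyfix hfix]; rfl
    have := cov.eq_of_comp_eq (A := unitInterval) (g₁ := fun t => L (t, z)) (g₂ := fun _ => L (0, z))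
      (L.continuous.comp (by fun_prop)) continuous_const
      (by
        funext t
        have e1 := congrFun hl (t, z)
        have e2 := congrFun hl (0, z)
        change ((L (t, z) : ℝ) : AddCircle (1:ℝ)) = C.u (rad (t, z)) at e1
        change ((L (0, z) : ℝ) : AddCircle (1:ℝ)) = C.u (rad (0, z)) at e2
        rw [rad_bd t z hz] at e1
        rw [rad_bd 0 z hz] at e2
        exact e1.trans e2.symm) 0 rfl
    exact (congrFun this 1).trans h0

/-- Global shift function. -/
lemma exists_alpha : ∃ α : Pt → ℝ, ContDiffOn ℝ (⊤ : ℕ∞) α Mset ∧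
    (∀ z ∈ Mset, C.h z = C.Φ.φ z (α z)) ∧
    (∀ z ∈ Mset, ∃ b, ∀ t, |α (C.Φ.φ z t)| ≤ b) ∧
    ((∀ z ∈ bdD, C.h z = z) → ∀ z ∈ bdD, α z = 0) := by
  classical
  obtain ⟨x, hxc, hxu, hxb⟩ := C.exists_x
  let α : Pt → ℝ := fun z => if hz : z ∈ Mset then x ⟨z, hz⟩ * C.θ ⟨z, hz⟩ else 0
  have hα : ∀ z : XM, α z = x z * C.θ z := fun z => by simp only [α, dif_pos z.2]
  have hcont : ContinuousOn α Mset := by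
    rw [continuousOn_iff_continuous_domRestrict]
    have : Mset.domRestrict α = fun z : XM => x z * C.θ z := funext hα
    rw [this]; exact hxc.mul C.θ_cont
  have hform : ∀ z ∈ Mset, C.h z = C.Φ.φ z (α z) := by
    intro z hz
    have := C.ψ_of_u (hxu ⟨z, hz⟩).symm
    rw [← hα] at this
    exact (congrArg Subtype.val this).symm
  refine ⟨α, ?_, hform, ?_, ?_⟩
  · have hh : ContDiffOn ℝ (⊤ : ℕ∞) C.h Mset := C.h_smooth.mono sdiff_subset
    have hFh : ContDiffOn ℝ (⊤ : ℕ∞) (fun z => C.Φ.F (C.h z)) Mset :=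
      C.Φ.F_smooth.comp hh (fun z hz => (C.h_M hz).1)
    refine contDiffOn_implicit uniqueDiff_M
      (Ψ := fun p : Pt × ℝ => dot2 (C.Φ.φ p.1 p.2) (C.Φ.F (C.h p.1)))
      (k := fun z => dot2 (C.h z) (C.Φ.F (C.h z)))
      (b := fun z => dot2 (C.Φ.F (C.h z)) (C.Φ.F (C.h z))) ?_ (dot2_smooth hh hFh) hcont ?_ ?_ ?_
    · refine dot2_smooth (C.Φ.φ_smooth.mono (prod_mono sdiff_subset subset_rfl)) ?_
      exact hFh.comp (f := fun p : Pt × ℝ => p.1) contDiffOn_fst (fun p hp => hp.1)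
    · intro z hz; simp only; rw [← hform z hz]
    · intro z hz
      have h1 := C.Φ.φ_deriv z hz.1 (α z)
      rw [← hform z hz] at h1
      exact dot2_deriv (v := C.Φ.F (C.h z)) h1
    · intro z hz
      exact (dot2_self_pos (F_ne (C.h_M hz))).ne'
  · intro z hz
    have hk : IsCompact ((fun s => C.ψ ⟨z, hz⟩ s) '' Icc 0 (C.θ ⟨z, hz⟩)) :=
      isCompact_Icc.image (C.ψ_cont' continuous_const continuous_id)
    obtain ⟨b, hb⟩ := (hk.image (hxc.mul C.θ_cont)).isBounded.exists_norm_le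
    refine ⟨b, fun t => ?_⟩
    have hT := C.θ_pos ⟨z, hz⟩
    set T := C.θ ⟨z, hz⟩ with hTdef
    have e : C.ψ ⟨z, hz⟩ t = C.ψ ⟨z, hz⟩ (Int.fract (t / T) * T) := by
      rw [C.ψ_eq_iff]
      have : t - Int.fract (t / T) * T = ((⌊t / T⌋ : ℤ) : ℝ) * T := by
        rw [Int.fract]; field_simp; ring
      rw [this]; exact C.int_per _ _
    have := hb _ ⟨C.ψ ⟨z, hz⟩ t, ⟨Int.fract (t / T) * T, ⟨by have := Int.fract_nonneg (t / T); positivity,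
      by have := (Int.fract_lt_one (t / T)).le; nlinarith⟩, e.symm⟩, rfl⟩
    rw [Real.norm_eq_abs] at this
    have e2 := hα (C.ψ ⟨z, hz⟩ t)
    simp only [ψ_coe] at e2
    rw [e2]; exact this
  · intro hfix z hz
    rw [hα ⟨z, bd_subset hz⟩, hxb hfix _ hz, zero_mul]

end HC
end Part6

section Part7
open Set Filter Topology

structure FC extends HC where
  α : Pt → ℝ
  α_sm : ContDiffOn ℝ (⊤ : ℕ∞) α Mset
  α_form : ∀ z ∈ Mset, h z = Φ.φ z (α z)
  α_bdd : ∀ z ∈ Mset, ∃ b, ∀ t, |α (Φ.φ z t)| ≤ b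
  U : Set Pt
  V : Set Pt
  g : Pt → Pt
  hU : IsOpen U
  hV : IsOpen V
  hOU : ptO ∈ U
  hOV : ptO ∈ V
  hUD : U ⊆ diskD
  hVD : V ⊆ diskD
  bij : BijOn h U V
  g_sm : ContDiffOn ℝ (⊤ : ℕ∞) g V
  g_inv : ∀ z ∈ U, g (h z) = z
  c2 : ℝ
  c2_pos : 0 < c2
  c2_le : c2 ≤ 1
  hc2 : ∀ z ∈ diskD, f z < c2 → z ∈ U ∧ 0 < (toHC.Dh z).det

namespace FC
open TCFlow Ctx HC
variable (C : FC)

def mu (c : ℝ) : ℝ := Real.smoothTransition ((c - C.c2 / 2) / (C.c2 / 2))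

lemma mu_low {c : ℝ} (hc : c ≤ C.c2 / 2) : C.mu c = 0 := by
  have := C.c2_pos
  exact Real.smoothTransition.zero_of_nonpos (div_nonpos_of_nonpos_of_nonneg (by linarith) (by linarith))

lemma mu_high {c : ℝ} (hc : C.c2 ≤ c) : C.mu c = 1 := by
  have := C.c2_pos
  refine Real.smoothTransition.one_of_one_le ((one_le_div (by linarith)).2 (by linarith))

lemma mu_nonneg (c : ℝ) : 0 ≤ C.mu c := Real.smoothTransition.nonneg _
lemma mu_le (c : ℝ) : C.mu c ≤ 1 := Real.smoothTransition.le_one _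

lemma mu_sm : ContDiff ℝ (⊤ : ℕ∞) C.mu := by
  unfold mu
  exact Real.smoothTransition.contDiff.comp (by fun_prop)

def β (t : ℝ) (z : Pt) : ℝ := (1 - t * C.mu (C.f z)) * C.α z

open Classical in
def H (t : ℝ) (z : Pt) : Pt := if z = ptO then C.h z else C.Φ.φ z (C.β t z)

lemma H_M (t : ℝ) {z : Pt} (hz : z ∈ Mset) : C.H t z = C.Φ.φ z (C.β t z) := if_neg hz.2
lemma H_O (t : ℝ) : C.H t ptO = ptO := (if_pos rfl).trans C.h_O

lemma M_or {z : Pt} (hz : z ∈ diskD) : z = ptO ∨ z ∈ Mset := by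
  by_cases h : z = ptO
  · exact Or.inl h
  · exact Or.inr ⟨hz, h⟩

lemma H_low (t : ℝ) {z : Pt} (hz : z ∈ diskD) (hl : C.f z ≤ C.c2 / 2) : C.H t z = C.h z := by
  rcases M_or hz with rfl | hM
  · exact if_pos rfl
  · rw [C.H_M t hM, β, C.mu_low hl, C.α_form z hM]; congr 1; ring

lemma H_zero {z : Pt} (hz : z ∈ diskD) : C.H 0 z = C.h z := by
  rcases M_or hz with rfl | hM
  · exact if_pos rfl
  · rw [C.H_M 0 hM, β, C.α_form z hM]; congr 1; ring

lemma H_maps (t : ℝ) {z : Pt} (hz : z ∈ diskD) : C.H t z ∈ diskD := by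
  rcases M_or hz with rfl | hM
  · rw [H_O]; exact hz
  · rw [C.H_M t hM]; exact C.Φ.φ_mapsTo _ hz _

lemma f_H (t : ℝ) {z : Pt} (hz : z ∈ diskD) : C.f (C.H t z) = C.f z := by
  rcases M_or hz with rfl | hM
  · rw [H_O]
  · rw [C.H_M t hM, f_φ C.hf hz]

lemma H_mapsM (t : ℝ) {z : Pt} (hz : z ∈ Mset) : C.H t z ∈ Mset := by
  rw [C.H_M t hz]; exact φ_M C.hf hz _

lemma β_sm (t : ℝ) : ContDiffOn ℝ (⊤ : ℕ∞) (C.β t) Mset := by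
  have h1 : ContDiffOn ℝ (⊤ : ℕ∞) (fun z => C.mu (C.f z)) Mset :=
    C.mu_sm.comp_contDiffOn C.hf.2.2.1
  exact (contDiffOn_const.sub (contDiffOn_const.mul h1)).mul C.α_sm

lemma low_nhds : {z | C.f z < C.c2 / 2} ∈ 𝓝[diskD] ptO := by
  refine (C.hf.1 ptO ptO_mem).eventually (gt_mem_nhds ?_)
  rw [f_O C.hf]; linarith [C.c2_pos]

lemma H_smM (t : ℝ) : ContDiffOn ℝ (⊤ : ℕ∞) (C.H t) Mset := by
  have h1 : ContDiffOn ℝ (⊤ : ℕ∞) (fun z => C.Φ.φ z (C.β t z)) Mset := by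
    refine C.Φ.φ_smooth.comp (g := fun p : Pt × ℝ => C.Φ.φ p.1 p.2)
      (f := fun z => (z, C.β t z)) (contDiffOn_id.prodMk (C.β_sm t))
      (fun z hz => ⟨hz.1, mem_univ _⟩)
  exact h1.congr (fun z hz => C.H_M t hz)

lemma H_sm (t : ℝ) : ContDiffOn ℝ (⊤ : ℕ∞) (C.H t) diskD := by
  intro z hz
  rcases M_or hz with rfl | hM
  · refine (C.h_smooth ptO ptO_mem).congr_of_eventuallyEq ?_ (C.H_low t ptO_mem ?_)
    · filter_upwards [C.low_nhds, self_mem_nhdsWithin] with w hw hwD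
      exact C.H_low t hwD (le_of_lt hw)
    · rw [f_O C.hf]; linarith [C.c2_pos]
  · exact (C.H_smM t z hM).mono_of_mem_nhdsWithin (M_mem_nhdsWithin hM)

lemma H_jcont : ContinuousOn (fun p : ℝ × Pt => C.H p.1 p.2) (univ ×ˢ diskD) := by
  rintro ⟨t, z⟩ ⟨-, hz⟩
  rcases M_or hz with rfl | hM
  · have h1 : ContinuousWithinAt (fun p : ℝ × Pt => C.h p.2) (univ ×ˢ diskD) (t, ptO) :=
      (C.h_smooth.continuousOn ptO ptO_mem).comp (f := fun p : ℝ × Pt => p.2)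
        continuousWithinAt_snd (fun p hp => hp.2)
    refine h1.congr_of_eventuallyEq ?_ (C.H_low t ptO_mem ?_)
    · have h2 : ∀ᶠ p : ℝ × Pt in 𝓝[univ ×ˢ diskD] (t, ptO), C.f p.2 < C.c2 / 2 := by
        rw [nhdsWithin_prod_eq]
        exact (tendsto_snd (f := 𝓝[univ] t) (g := 𝓝[diskD] ptO)).eventually C.low_nhds
      filter_upwards [h2, self_mem_nhdsWithin] with p hp hpD
      exact C.H_low p.1 hpD.2 (le_of_lt hp)
    · rw [f_O C.hf]; linarith [C.c2_pos]
  · have hαc : ContinuousOn (fun p : ℝ × Pt => C.α p.2) (univ ×ˢ Mset) :=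
      C.α_sm.continuousOn.comp continuousOn_snd (fun p hp => hp.2)
    have hmc : ContinuousOn (fun p : ℝ × Pt => C.mu (C.f p.2)) (univ ×ˢ Mset) :=
      C.mu_sm.continuous.comp_continuousOn
        (C.hf.1.comp continuousOn_snd (fun p hp => hp.2.1))
    have hβ : ContinuousOn (fun p : ℝ × Pt => C.β p.1 p.2) (univ ×ˢ Mset) :=
      (continuousOn_const.sub (continuousOn_fst.mul hmc)).mul hαc
    have h1 : ContinuousOn (fun p : ℝ × Pt => C.Φ.φ p.2 (C.β p.1 p.2)) (univ ×ˢ Mset) :=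
      C.Φ.φ_cont.comp (f := fun p : ℝ × Pt => (p.2, C.β p.1 p.2))
        (continuousOn_snd.prodMk hβ) (fun p hp => ⟨hp.2.1, mem_univ _⟩)
    have h2 : ContinuousOn (fun p : ℝ × Pt => C.H p.1 p.2) (univ ×ˢ Mset) :=
      h1.congr (fun p hp => C.H_M p.1 hp.2)
    refine (h2 (t, z) ⟨mem_univ _, hM⟩).mono_of_mem_nhdsWithin ?_
    rw [nhdsWithin_prod_eq]
    exact prod_mem_prod (by simp) (M_mem_nhdsWithin hM)

/-- lift of `H` on an orbit -/
def σ (t : ℝ) (z : Pt) (s : ℝ) : ℝ := s + C.β t (C.Φ.φ z s)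

lemma H_φ (t : ℝ) {z : Pt} (hz : z ∈ Mset) (s : ℝ) : C.H t (C.Φ.φ z s) = C.Φ.φ z (C.σ t z s) := by
  rw [C.H_M t (φ_M C.hf hz s), C.Φ.φ_add z hz.1]; rfl

lemma σ_cont (t : ℝ) {z : Pt} (hz : z ∈ Mset) : Continuous (C.σ t z) :=
  continuous_id.add ((C.β_sm t).continuousOn.comp_continuous (C.Φ.φ_contT hz.1)
    (fun s => φ_M C.hf hz s))

lemma H_orb (t : ℝ) {z : Pt} (hz : z ∈ diskD) : C.H t '' orb C.Φ z = orb C.Φ z := by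
  apply Subset.antisymm
  · rintro _ ⟨w, hw, rfl⟩
    rw [← level_eq C.hf hz] at hw ⊢
    exact ⟨C.H_maps t hw.1, (C.f_H t hw.1).trans hw.2⟩
  · intro w hw
    rcases M_or hz with rfl | hM
    · have hw' := hw
      rw [← level_eq C.hf hz] at hw'
      have : w = ptO := (C.hf.2.2.2.2.1 w hw'.1).1 (hw'.2.trans (f_O C.hf))
      exact ⟨ptO, self_mem_orb C.Φ hz, by rw [H_O, this]⟩
    · obtain ⟨s0, rfl⟩ := hw
      obtain ⟨b, hb⟩ := C.α_bdd z hM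
      set B := |1 - t * C.mu (C.f z)| * b
      have hB : ∀ s, |C.σ t z s - s| ≤ B := fun s => by
        have : C.σ t z s - s = (1 - t * C.mu (C.f z)) * C.α (C.Φ.φ z s) := by
          rw [σ, β, f_φ C.hf hz]; ring
        rw [this, abs_mul]
        exact mul_le_mul_of_nonneg_left (hb s) (abs_nonneg _)
      have hB0 : 0 ≤ B := (abs_nonneg _).trans (hB 0)
      have h1 := abs_le.1 (hB (s0 - B))
      have h2 := abs_le.1 (hB (s0 + B))
      obtain ⟨s, -, hs⟩ : s0 ∈ C.σ t z '' Icc (s0 - B) (s0 + B) :=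
        intermediate_value_Icc (by linarith) (C.σ_cont t hM).continuousOn
          ⟨by linarith [h1.2], by linarith [h2.1]⟩
      exact ⟨C.Φ.φ z s, ⟨s, rfl⟩, by rw [C.H_φ t hM, hs]⟩

lemma H_E (t : ℝ) : Emem C.Φ (C.H t) := by
  refine ⟨fun z hz => C.H_maps t hz, C.H_sm t, fun z hz => C.H_orb t hz, ?_⟩
  have hopen : ∀ W : Set Pt, IsOpen W → W ⊆ diskD → IsOpen (W ∩ C.f ⁻¹' (Iio (C.c2 / 2))) :=
    fun W hW hWD => (C.hf.1.mono hWD).isOpen_inter_preimage hW isOpen_Iio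
  have hO : ptO ∈ C.f ⁻¹' (Iio (C.c2 / 2)) := by
    rw [mem_preimage, f_O C.hf]; exact half_pos C.c2_pos
  have heq : EqOn C.h (C.H t) (C.U ∩ C.f ⁻¹' (Iio (C.c2 / 2))) := fun z hz =>
    (C.H_low t (C.hUD hz.1) (le_of_lt hz.2)).symm
  refine ⟨C.U ∩ C.f ⁻¹' (Iio (C.c2 / 2)), C.V ∩ C.f ⁻¹' (Iio (C.c2 / 2)), hopen _ C.hU C.hUD,
    hopen _ C.hV C.hVD, ⟨C.hOU, hO⟩, ⟨C.hOV, hO⟩, fun z hz => C.hUD hz.1, fun z hz => C.hVD hz.1,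
    BijOn.congr ?_ heq, C.g, C.g_sm.mono inter_subset_left, fun z hz => ?_⟩
  · refine ⟨fun z hz => ⟨C.bij.mapsTo hz.1, ?_⟩, C.bij.injOn.mono inter_subset_left, ?_⟩
    · rw [mem_preimage, C.f_h (C.hUD hz.1)]; exact hz.2
    · intro w hw
      obtain ⟨z, hz, rfl⟩ := C.bij.surjOn hw.1
      refine ⟨z, ⟨hz, ?_⟩, rfl⟩
      have := hw.2
      rw [mem_preimage, C.f_h (C.hUD hz)] at this; exact this
  · rw [← heq hz]; exact C.g_inv z hz.1

lemma H_fderiv (t : ℝ) : fderiv ℝ (C.H t) ptO = fderiv ℝ C.h ptO := by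
  apply Filter.EventuallyEq.fderiv_eq
  have h1 := C.low_nhds
  rw [nhdsWithin_eq_nhds.2 disk_nhds_O] at h1
  filter_upwards [h1, disk_nhds_O] with z hz hzD
  exact C.H_low t hzD (le_of_lt hz)

lemma H_Epl (t : ℝ) : EplMem C.Φ (C.H t) := ⟨C.H_E t, by rw [H_fderiv]; exact C.hh.2⟩

def Dα (z : Pt) : ℝ := fderivWithin ℝ C.α Mset z (C.Φ.F z)
def lamt (t : ℝ) (z : Pt) : ℝ := 1 + (1 - t * C.mu (C.f z)) * C.Dα z

lemma σ_deriv (t : ℝ) {z : Pt} (hz : z ∈ Mset) (s : ℝ) :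
    HasDerivAt (C.σ t z) (C.lamt t (C.Φ.φ z s)) s := by
  have h0 := φ_M C.hf hz s
  have h1 : HasDerivAt (fun s => C.α (C.Φ.φ z s)) (C.Dα (C.Φ.φ z s)) s := by
    have := ((C.α_sm.differentiableOn (by simp)) _ h0).hasFDerivWithinAt.comp_hasDerivWithinAt s
      ((C.Φ.φ_deriv z hz.1 s).hasDerivWithinAt (s := univ)) (fun s _ => φ_M C.hf hz s)
    exact hasDerivWithinAt_univ.1 this
  have h2 := (hasDerivAt_id s).add (h1.const_mul (1 - t * C.mu (C.f z)))
  have h3 : C.σ t z = (id + fun s => (1 - t * C.mu (C.f z)) * C.α (C.Φ.φ z s)) := by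
    funext r
    simp only [σ, β, f_φ C.hf hz.1]; rfl
  rw [h3, lamt, f_φ C.hf hz.1]; exact h2

lemma DH_has (t : ℝ) {z : Pt} (hz : z ∈ diskD) :
    HasFDerivWithinAt (C.H t) (fderivWithin ℝ (C.H t) diskD z) diskD z :=
  (((C.H_sm t).differentiableOn (by simp)) z hz).hasFDerivWithinAt

lemma DH_F (t : ℝ) {z : Pt} (hz : z ∈ Mset) :
    fderivWithin ℝ (C.H t) diskD z (C.Φ.F z) = C.lamt t z • C.Φ.F (C.H t z) := by
  have hz0 : C.Φ.φ z 0 = z := C.Φ.φ_zero z hz.1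
  have h1 : HasDerivAt (fun s => C.H t (C.Φ.φ z s))
      (fderivWithin ℝ (C.H t) diskD z (C.Φ.F z)) 0 := by
    have h2 := C.DH_has t (C.Φ.φ_mapsTo z hz.1 0)
    have := h2.comp_hasDerivWithinAt 0
      ((C.Φ.φ_deriv z hz.1 0).hasDerivWithinAt (s := univ)) (fun s _ => C.Φ.φ_mapsTo z hz.1 s)
    rw [hz0] at this
    exact hasDerivWithinAt_univ.1 this
  have h2 : HasDerivAt (fun s => C.Φ.φ z (C.σ t z s))
      (C.lamt t (C.Φ.φ z 0) • C.Φ.F (C.Φ.φ z (C.σ t z 0))) 0 :=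
    (C.Φ.φ_deriv z hz.1 (C.σ t z 0)).scomp 0 (C.σ_deriv t hz 0)
  have h3 : (fun s => C.H t (C.Φ.φ z s)) = fun s => C.Φ.φ z (C.σ t z s) :=
    funext fun s => C.H_φ t hz s
  rw [h3] at h1
  have := h1.unique h2
  rw [this, ← C.H_φ t hz, hz0]

lemma Dh_F {z : Pt} (hz : z ∈ Mset) :
    C.Dh z (C.Φ.F z) = C.lamt 0 z • C.Φ.F (C.h z) := by
  have h1 := C.DH_F 0 hz
  rw [C.H_zero hz.1] at h1
  rw [← h1, HC.Dh]
  congr 1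
  exact fderivWithin_congr (fun w hw => (C.H_zero hw).symm) (C.H_zero hz.1).symm

lemma lam_low {z : Pt} (hz : z ∈ Mset) (hl : C.f z < C.c2) : 0 < C.lamt 0 z :=
  C.lam_pos hz (C.Dh_F hz) (C.hc2 z hz.1 hl).2

lemma lamt_eq (t : ℝ) (z : Pt) :
    C.lamt t z = t * C.mu (C.f z) + (1 - t * C.mu (C.f z)) * C.lamt 0 z := by
  simp only [lamt]; ring

lemma lamt_pos {t : ℝ} (ht : t ∈ Icc (0:ℝ) 1) {z : Pt} (h : 0 < C.lamt 0 z) : 0 < C.lamt t z := by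
  rw [lamt_eq]
  have h1 := C.mu_nonneg (C.f z)
  have h2 := C.mu_le (C.f z)
  have h3 : 0 ≤ t * C.mu (C.f z) := mul_nonneg ht.1 h1
  have h4 : t * C.mu (C.f z) ≤ 1 := mul_le_one₀ ht.2 h1 h2
  rcases h4.lt_or_eq with h | h
  · have : 0 < (1 - t * C.mu (C.f z)) * C.lamt 0 z := mul_pos (by linarith) ‹_›
    linarith
  · rw [h]; norm_num

lemma lam1_pos {z : Pt} (hz : z ∈ Mset) : 0 < C.lamt 1 z := by
  rcases lt_or_ge (C.f z) C.c2 with h | h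
  · exact C.lamt_pos (by simp) (C.lam_low hz h)
  · rw [lamt, C.mu_high h]; norm_num

lemma lam_pos_of_D (hD : DmemTC C.Φ C.h) {z : Pt} (hz : z ∈ Mset) : 0 < C.lamt 0 z := by
  obtain ⟨-, -, g, hg, hgh, -⟩ := hD
  have hne : ∀ z ∈ Mset, C.lamt 0 z ≠ 0 := by
    intro z hz h0
    have h1 := C.Dh_F hz
    rw [h0, zero_smul] at h1
    have h2 := ((hg.differentiableOn (by simp)) _ (C.h_maps hz.1)).hasFDerivWithinAt.comp z
      (C.Dh_has hz.1) (fun w hw => C.h_maps hw)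
    have h3 : HasFDerivWithinAt (g ∘ C.h) (ContinuousLinearMap.id ℝ Pt) diskD z :=
      (hasFDerivWithinAt_id z diskD).congr (fun w hw => hgh w hw) (hgh z hz.1)
    have h4 := (uniqueDiff_disk z hz.1).eq h2 h3
    have h5 := congrArg (fun L : Pt →L[ℝ] Pt => L (C.Φ.F z)) h4
    simp only [ContinuousLinearMap.comp_apply, h1, map_zero, ContinuousLinearMap.id_apply] at h5
    exact F_ne hz h5.symm
  have hcont : ContinuousOn (C.lamt 0) Mset := by
    have h1 : ContinuousOn C.Dα Mset :=
      (C.α_sm.continuousOn_fderivWithin uniqueDiff_M (by simp)).clm_apply (F_cont.mono sdiff_subset)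
    have h2 : C.lamt 0 = fun z => 1 + C.Dα z := by funext z; simp [lamt]
    rw [h2]; exact continuousOn_const.add h1
  obtain ⟨w, hw, hfw⟩ := C.exists_level (c := C.c2 / 2)
    ⟨by linarith [C.c2_pos], by linarith [C.c2_le, C.c2_pos]⟩
  have hwM : w ∈ Mset := (M_iff C.hf hw).2 (by linarith [C.c2_pos])
  have h1 := C.lam_low hwM (by linarith [C.c2_pos])
  exact (pos_iff_pos_of_mul_pos (sign_const hcont hne hwM hz)).1 h1

end FC

lemma exists_cont_inv {K : Set Pt} (hK : IsCompact K) {k : Pt → Pt} (hk : ContinuousOn k K)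
    (hb : BijOn k K K) : ∃ g : Pt → Pt, ContinuousOn g K ∧ MapsTo g K K ∧
      (∀ z ∈ K, g (k z) = z) ∧ (∀ z ∈ K, k (g z) = z) := by
  classical
  haveI : CompactSpace K := isCompact_iff_compactSpace.1 hK
  let e : K ≃ K := hb.equiv k
  have he : Continuous e := Continuous.subtype_mk
    (hk.comp_continuous continuous_subtype_val (fun z => z.2)) _
  let E := he.homeoOfEquivCompactToT2
  have hes : Continuous e.symm := E.symm.continuous
  let g : Pt → Pt := fun z => if hz : z ∈ K then (e.symm ⟨z, hz⟩ : Pt) else 0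
  have hg : ∀ z : K, g z = e.symm z := fun z => by simp only [g, dif_pos z.2]
  refine ⟨g, ?_, ?_, ?_, ?_⟩
  · rw [continuousOn_iff_continuous_domRestrict]
    have : K.domRestrict g = fun z : K => (e.symm z : Pt) := funext hg
    rw [this]; exact continuous_subtype_val.comp hes
  · intro z hz
    rw [hg ⟨z, hz⟩]; exact (e.symm _).2
  · intro z hz
    have := hg (e ⟨z, hz⟩)
    rw [e.symm_apply_apply] at this; exact this
  · intro z hz
    rw [hg ⟨z, hz⟩]
    exact congrArg Subtype.val (e.apply_symm_apply ⟨z, hz⟩)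

namespace FC
open TCFlow Ctx HC
variable (C : FC)

lemma H_inj {t : ℝ} (hl : ∀ z ∈ Mset, 0 < C.lamt t z) : InjOn (C.H t) diskD := by
  intro z hz w hw he
  have hff : C.f w = C.f z := by rw [← C.f_H t hz, he, C.f_H t hw]
  rcases M_or hz with rfl | hM
  · exact ((C.hf.2.2.2.2.1 w hw).1 (hff.trans (f_O C.hf))).symm
  · obtain ⟨s, rfl⟩ := exists_time C.hf hz hw hff
    have hmono : StrictMono (C.σ t z) := strictMono_of_deriv_pos (fun r => by
      rw [(C.σ_deriv t hM r).deriv]; exact hl _ (φ_M C.hf hM r))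
    have h0 : C.H t z = C.Φ.φ z (C.σ t z 0) := by
      rw [← C.H_φ t hM, C.Φ.φ_zero z hz]
    rw [C.H_φ t hM, h0] at he
    set τ := C.σ t z s - C.σ t z 0 with hτ
    have hper : C.Φ.φ z τ = z := by
      have := congrArg (fun w => C.Φ.φ w (- C.σ t z 0)) he
      simp only [C.Φ.φ_add z hz] at this
      rw [add_neg_cancel, C.Φ.φ_zero z hz] at this
      rw [hτ, sub_eq_add_neg]; exact this.symm
    have h1 : C.σ t z τ = C.σ t z s := by
      have : C.σ t z τ = τ + C.σ t z 0 := by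
        simp only [σ, hper, C.Φ.φ_zero z hz]; ring
      rw [this, hτ]; ring
    have h2 := hmono.injective h1
    rw [← h2, hper]

lemma H_D {t : ℝ} (hl : ∀ z ∈ Mset, 0 < C.lamt t z) : DmemTC C.Φ (C.H t) := by
  have hb : BijOn (C.H t) diskD diskD := by
    refine ⟨fun z hz => C.H_maps t hz, C.H_inj hl, fun z hz => ?_⟩
    have h1 : z ∈ C.H t '' orb C.Φ z := by rw [C.H_orb t hz]; exact self_mem_orb C.Φ hz
    obtain ⟨w, ⟨s, rfl⟩, hw⟩ := h1
    exact ⟨_, C.Φ.φ_mapsTo z hz s, hw⟩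
  obtain ⟨g, hgc, hgm, hgl, hgr⟩ := exists_cont_inv isCompact_disk (C.H_sm t).continuousOn hb
  refine ⟨C.H_E t, hb, g, ?_, hgl, hgr⟩
  refine contDiffOn_of_comp uniqueDiff_disk uniqueDiff_disk (C.H_sm t) contDiffOn_id hgc hgm
    (fun z hz => hgr z hz) ?_
  intro w hw
  have hz := hgm hw
  set z := g w
  rcases M_or hz with h | hM
  · rw [h, fderivWithin_of_mem_nhds disk_nhds_O, H_fderiv]
    have hd := C.hh.2
    have hu := LinearMap.equivOfDetNeZero _ hd.ne'
    exact (LinearMap.equivOfDetNeZero _ hd.ne').injective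
  · rw [injective_iff_map_eq_zero]
    intro v hv
    have h1 := df_comp C.hf hM (fun w hw => C.H_mapsM t hw) (fun w hw => C.f_H t hw.1)
      ((C.DH_has t hz).mono sdiff_subset) v
    rw [hv, map_zero] at h1
    obtain ⟨c, hc⟩ := vec_of_func _ (C.Φ.F z) v (F_ne hM) (df_F C.hf hM) (C.hf.2.2.2.1 z hM) h1.symm
    rw [hc, map_smul, C.DH_F t hM, smul_smul] at hv
    rcases smul_eq_zero.1 hv with h | h
    · rcases mul_eq_zero.1 h with h | h
      · rw [hc, h, zero_smul]
      · exact absurd h (hl z hM).ne'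
    · exact absurd h (F_ne (C.H_mapsM t hM))

lemma H_one_bd {z : Pt} (hz : z ∈ bdD) : C.H 1 z = z := by
  have hM := bd_subset hz
  have h1 : C.f z = 1 := (C.hf.2.2.2.2.2.1 z hM.1).2 hz
  rw [C.H_M 1 hM, β, h1, C.mu_high C.c2_le]
  rw [show (1 - 1 * 1) * C.α z = 0 by ring, C.Φ.φ_zero z hM.1]

end FC

theorem deformation_aux
    (Φ : TCFlow) (f : Pt → ℝ) (hf : FirstStrongIntegral Φ f)
    (h : Pt → Pt) (hh : EplMem Φ h) :
    ∃ H : ℝ → Pt → Pt,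
      ContinuousOn (fun p : ℝ × Pt => H p.1 p.2) (Icc (0 : ℝ) 1 ×ˢ diskD) ∧
      (∀ z ∈ diskD, H 0 z = h z) ∧
      (∀ t ∈ Icc (0 : ℝ) 1, EplMem Φ (H t)) ∧
      DbdMem Φ (H 1) ∧
      (DplMem Φ h → ∀ t ∈ Icc (0 : ℝ) 1, DplMem Φ (H t)) ∧
      (EbdMem Φ h → ∀ t ∈ Icc (0 : ℝ) 1, EbdMem Φ (H t)) := by
  let C0 : HC := { Φ := Φ, f := f, hf := hf, h := h, hh := hh }
  obtain ⟨α, α1, α2, α3, α4⟩ := C0.exists_alpha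
  obtain ⟨U, V, hU, hV, hOU, hOV, hUD, hVD, hb, g, hg, hgi⟩ := hh.1.2.2.2
  obtain ⟨c2, hc0, hc1, hc2⟩ := C0.exists_c2 hU hOU
  let C : FC := { C0 with α := α, α_sm := α1, α_form := α2, α_bdd := α3, U := U, V := V, g := g, hU := hU, hV := hV, hOU := hOU, hOV := hOV, hUD := hUD, hVD := hVD, bij := hb, g_sm := hg, g_inv := hgi, c2 := c2, c2_pos := hc0, c2_le := hc1, hc2 := hc2 }
  refine ⟨C.H, C.H_jcont.mono (prod_mono (subset_univ _) subset_rfl), fun z hz => C.H_zero hz,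
    fun t _ => C.H_Epl t, ⟨C.H_D (fun z hz => C.lam1_pos hz), C.H_Epl 1, fun z hz => C.H_one_bd hz⟩,
    fun hD t ht => ⟨C.H_D (fun z hz => C.lamt_pos ht (C.lam_pos_of_D hD.1 hz)), C.H_Epl t⟩,
    fun hE t _ => ⟨C.H_Epl t, fun z hz => ?_⟩⟩
  have hM := bd_subset hz
  have h0 : C.α z = 0 := α4 hE.2 z hz
  rw [C.H_M t hM, FC.β, h0, mul_zero]
  exact Φ.φ_zero z hM.1

end Part7

/-- every `h ∈ E⁺(F)` can be deformed, through `E⁺(F)`, to an element of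
`D^∂(F)`; the deformation stays in `D⁺(F)` if `h ∈ D⁺(F)` and in `E^∂(F)` if
`h ∈ E^∂(F)`. -/
theorem deformation_to_DbdMem
    (Φ : TCFlow) (f : Pt → ℝ) (hf : FirstStrongIntegral Φ f)
    (h : Pt → Pt) (hh : EplMem Φ h) :
    ∃ H : ℝ → Pt → Pt,
      ContinuousOn (fun p : ℝ × Pt => H p.1 p.2) (Icc (0 : ℝ) 1 ×ˢ diskD) ∧
      (∀ z ∈ diskD, H 0 z = h z) ∧
      (∀ t ∈ Icc (0 : ℝ) 1, EplMem Φ (H t)) ∧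
      DbdMem Φ (H 1) ∧
      (DplMem Φ h → ∀ t ∈ Icc (0 : ℝ) 1, DplMem Φ (H t)) ∧
      (EbdMem Φ h → ∀ t ∈ Icc (0 : ℝ) 1, EbdMem Φ (H t)) := by
  exact deformation_aux Φ f hf h hh

end
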